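/- arXiv:2105.07183 — 2 statements merged into one kernel-verified Lean document; each statement's English description precedes it below -/
import Mathlib

section
/- Assume that the weight functions a_ij : [0,∞) → [0,∞) possess the non-instantaneous type-symmetry (NITS) property and satisfy the uniform local integrability assumption. Then for every delay bound h̄ ≥ 0 and all measurable delays h_ij(t) ∈ [0,h̄]: (i) every solution x of the continuous-time delayed averaging algorithm converges, i.e., the limits x̄_i = lim_{t→∞} x_i(t) exist for all i ∈ V; (ii) if agents i and j belong to the same connected component of the persistent graph G∞ (i.e., are joined by a walk in G∞), then x̄_i = x̄_j for every solution; (iii) if i and j belong to different connected components of G∞, then some solution has x̄_i ≠ x̄_j; consequently, the algorithm establishes global consensus if and only if G∞ is connected. -/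
open MeasureTheory Filter Topology Set

/-- There is a root node connected to every node by a directed walk. -/
def QSCrel {α : Type*} (r : α → α → Prop) : Prop :=
  ∃ root : α, ∀ i : α, Relation.ReflTransGen r root i

/-- The graph of the nonnegative matrix `B` (arc `(j,i)` iff `B i j > 0`), with all
entries smaller than `ε` zeroed out, is quasi-strongly connected. -/
def QSCeps {V : Type*} (ε : ℝ) (B : V → V → ℝ) : Prop :=
  QSCrel (fun u v : V => ε ≤ B v u)

variable {V : Type*} [Fintype V] [DecidableEq V]

/-- An increasing sequence of times tending to infinity, starting in `[0,∞)`. -/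
def IncrSeq (tp : ℕ → ℝ) : Prop :=
  StrictMono tp ∧ Tendsto tp atTop atTop ∧ 0 ≤ tp 0

/-- `(t_p)`-boundedness of the matrix function `A(⬝) = (a i j ⬝)`. -/
def tpBounded (a : V → V → ℝ → ℝ) (tp : ℕ → ℝ) : Prop :=
  ∃ L : ℝ, ∀ p : ℕ, ∀ i j : V, i ≠ j → (∫ s in (tp p)..(tp (p+1)), a i j s) ≤ L

/-- Aperiodic quasi-strong connectivity. -/
def AQSC (a : V → V → ℝ → ℝ) : Prop :=
  ∃ ε > (0:ℝ), ∃ tp : ℕ → ℝ, IncrSeq tp ∧ tpBounded a tp ∧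
    ∀ p : ℕ, QSCeps ε (fun i j => ∫ s in (tp p)..(tp (p+1)), a i j s)

/-- Non-instantaneous type-symmetry. -/
def NITS (a : V → V → ℝ → ℝ) : Prop :=
  ∃ K ≥ (1:ℝ), ∃ tp : ℕ → ℝ, IncrSeq tp ∧ tpBounded a tp ∧
    ∀ p : ℕ, ∀ i j : V,
      (1/K) * (∫ s in (tp p)..(tp (p+1)), a j i s) ≤ (∫ s in (tp p)..(tp (p+1)), a i j s) ∧
      (∫ s in (tp p)..(tp (p+1)), a i j s) ≤ K * (∫ s in (tp p)..(tp (p+1)), a j i s)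

/-- Uniform local integrability of the weights. -/
def ULI (a : V → V → ℝ → ℝ) : Prop :=
  ∀ D > (0:ℝ), ∃ M : ℝ, ∀ t ≥ (0:ℝ), ∀ i j : V, i ≠ j → (∫ s in t..(t+D), a i j s) ≤ M

/-- Admissible weights: measurable, nonnegative, locally integrable. -/
def Weights (a : V → V → ℝ → ℝ) : Prop :=
  ∀ i j : V, i ≠ j → Measurable (a i j) ∧ (∀ t ≥ (0:ℝ), 0 ≤ a i j t) ∧
    ∀ T : ℝ, IntegrableOn (a i j) (Icc 0 T)

/-- Admissible delays: measurable with values in `[0, h̄]`. -/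
def Delays (h : V → V → ℝ → ℝ) (hbar : ℝ) : Prop :=
  ∀ i j : V, Measurable (h i j) ∧ ∀ t ≥ (0:ℝ), h i j t ∈ Icc (0:ℝ) hbar

/-- Right-hand side of the delayed averaging dynamics. -/
def rhs (a h : V → V → ℝ → ℝ) (x : ℝ → V → ℝ) (i : V) (s : ℝ) : ℝ :=
  ∑ j ∈ Finset.univ.erase i, a i j s * (x (s - h i j s) j - x s i)

/-- A solution of the continuous-time delayed averaging algorithm with starting time `tstar`. -/
def IsSol (a h : V → V → ℝ → ℝ) (hbar tstar : ℝ) (x : ℝ → V → ℝ) : Prop :=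
  (∀ i : V, AEStronglyMeasurable (fun s => x s i) (volume.restrict (Icc (tstar - hbar) tstar))) ∧
  (∃ M : ℝ, ∀ s ∈ Icc (tstar - hbar) tstar, ∀ i : V, |x s i| ≤ M) ∧
  ∀ i : V, ∀ t ≥ tstar,
    IntervalIntegrable (rhs a h x i) volume tstar t ∧
    x t i = x tstar i + ∫ s in tstar..t, rhs a h x i s

/-- `Λ(t)`: supremum of the values over the window `[t-h̄, t]`. -/
noncomputable def Lam (hbar : ℝ) (x : ℝ → V → ℝ) (t : ℝ) : ℝ :=
  sSup {v | ∃ s ∈ Icc (t - hbar) t, ∃ i : V, x s i = v}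

/-- `λ(t)`: infimum of the values over the window `[t-h̄, t]`. -/
noncomputable def lam (hbar : ℝ) (x : ℝ → V → ℝ) (t : ℝ) : ℝ :=
  sInf {v | ∃ s ∈ Icc (t - hbar) t, ∃ i : V, x s i = v}

/-- Arc `(j,i)` of the persistent graph: `∫₀^∞ a i j = ∞`. -/
def PArc (a : V → V → ℝ → ℝ) (j i : V) : Prop :=
  j ≠ i ∧ (∫⁻ t in Ioi (0:ℝ), ENNReal.ofReal (a i j t)) = ⊤

/-- `i` and `j` are joined by a walk in the persistent graph. -/
def JoinedG (a : V → V → ℝ → ℝ) (i j : V) : Prop :=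
  Relation.ReflTransGen (fun u v => PArc a u v) i j

/-- `f` is a primitive of `φ` on `[S,T]`. -/
def Prim (f φ : ℝ → ℝ) (S T : ℝ) : Prop :=
  IntervalIntegrable φ volume S T ∧ ∀ t ∈ Icc S T, f t = f S + ∫ s in S..t, φ s

namespace Prim

lemma ac_canon {φ : ℝ → ℝ} {S T c : ℝ} (hST : S ≤ T) (h : IntervalIntegrable φ volume S T) :
    AbsolutelyContinuousOnInterval (fun t => c + ∫ s in S..t, φ s) S T := by
  have h1 := h.absolutelyContinuousOnInterval_intervalIntegral (c := S) left_mem_uIcc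
  have h2 : AbsolutelyContinuousOnInterval (fun _ : ℝ => c) S T :=
    (contDiff_const.contDiffOn (s := uIcc S T) (n := 1)).absolutelyContinuousOnInterval
  exact h2.add h1

lemma of_ac {f φ : ℝ → ℝ} {S T : ℝ} (hST : S ≤ T)
    (hf : AbsolutelyContinuousOnInterval f S T)
    (hd : ∀ᵐ x, x ∈ uIcc S T → HasDerivAt f (φ x) x) : Prim f φ S T := by
  have hae : ∀ᵐ x, x ∈ uIcc S T → deriv f x = φ x := by
    filter_upwards [hd] with x hx hx2 using (hx hx2).deriv
  have hi := hf.intervalIntegrable_deriv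
  have hcongr : deriv f =ᵐ[volume.restrict (uIoc S T)] φ := by
    rw [EventuallyEq, ae_restrict_iff' measurableSet_uIoc]
    filter_upwards [hae] with x hx hx2 using hx (uIoc_subset_uIcc hx2)
  refine ⟨hi.congr_ae hcongr, fun t ht => ?_⟩
  have hsub : uIcc S t ⊆ uIcc S T := by
    rw [uIcc_of_le hST, uIcc_of_le ht.1]; exact Icc_subset_Icc_right ht.2
  have h1 := (hf.mono hsub).integral_deriv_eq_sub
  have h2 : ∫ s in S..t, φ s = ∫ s in S..t, deriv f s := by
    apply intervalIntegral.integral_congr_ae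
    filter_upwards [hae] with x hx hx2
    exact (hx (hsub (uIoc_subset_uIcc hx2))).symm
  rw [h2, h1]; ring

variable {f g φ γ : ℝ → ℝ} {S T : ℝ}

lemma congr (h : Prim f φ S T) (hg : ∀ t ∈ Icc S T, g t = f t) (hST : S ≤ T) : Prim g φ S T := by
  refine ⟨h.1, fun t ht => ?_⟩
  rw [hg t ht, hg S ⟨le_rfl, hST⟩]; exact h.2 t ht

lemma congr_ig (h : Prim f φ S T) (hg : ∀ t ∈ Icc S T, γ t = φ t) (hST : S ≤ T) :
    Prim f γ S T := by
  refine ⟨h.1.congr (fun t ht => ?_), fun t ht => ?_⟩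
  · rw [uIoc_of_le hST] at ht; exact (hg t ⟨ht.1.le, ht.2⟩).symm
  · rw [h.2 t ht]; congr 1
    apply intervalIntegral.integral_congr
    intro s hs
    rw [uIcc_of_le ht.1] at hs
    exact (hg s ⟨hs.1, hs.2.trans ht.2⟩).symm

lemma intervalIntegrable (h : Prim f φ S T) {s t : ℝ} (hs : S ≤ s) (hst : s ≤ t) (ht : t ≤ T) :
    IntervalIntegrable φ volume s t :=
  h.1.mono_set (by
    rw [uIcc_of_le hst, uIcc_of_le (hs.trans (hst.trans ht))]; exact Icc_subset_Icc hs ht)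

lemma sub_eq (h : Prim f φ S T) {s t : ℝ} (hs : S ≤ s) (hst : s ≤ t) (ht : t ≤ T) :
    f t = f s + ∫ r in s..t, φ r := by
  rw [h.2 t ⟨hs.trans hst, ht⟩, h.2 s ⟨hs, hst.trans ht⟩, add_assoc,
    intervalIntegral.integral_add_adjacent_intervals
      (h.intervalIntegrable le_rfl hs (hst.trans ht)) (h.intervalIntegrable hs hst ht)]

lemma mono (h : Prim f φ S T) {s t : ℝ} (hs : S ≤ s) (hst : s ≤ t) (ht : t ≤ T) :
    Prim f φ s t :=
  ⟨h.intervalIntegrable hs hst ht, fun r hr => h.sub_eq hs hr.1 (hr.2.trans ht)⟩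

lemma continuousOn (h : Prim f φ S T) (hST : S ≤ T) : ContinuousOn f (Icc S T) := by
  have := (ac_canon (c := f S) hST h.1).continuousOn
  rw [uIcc_of_le hST] at this
  exact this.congr h.2

lemma ae_deriv (h : Prim f φ S T) :
    ∀ᵐ x, x ∈ uIcc S T → HasDerivAt (fun t => f S + ∫ s in S..t, φ s) (φ x) x := by
  filter_upwards [h.1.ae_hasDerivAt_integral] with x hx hx2
  simpa using (hx hx2 S left_mem_uIcc).const_add (f S)

lemma mul (hf : Prim f φ S T) (hg : Prim g γ S T) (hST : S ≤ T) :
    Prim (fun t => f t * g t) (fun t => φ t * g t + f t * γ t) S T := by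
  have h1 := ac_canon (c := f S) hST hf.1
  have h2 := ac_canon (c := g S) hST hg.1
  have h3 : Prim _ (fun x => φ x * (g S + ∫ s in S..x, γ s) + (f S + ∫ s in S..x, φ s) * γ x) S T :=
    of_ac hST (h1.fun_mul h2) (by
      filter_upwards [hf.ae_deriv, hg.ae_deriv] with x hx1 hx2 hx
      exact (hx1 hx).mul (hx2 hx))
  refine (h3.congr ?_ hST).congr_ig ?_ hST
  · intro t ht; rw [hf.2 t ht, hg.2 t ht]
  · intro t ht; rw [← hf.2 t ht, ← hg.2 t ht]

lemma exp (hf : Prim f φ S T) (hST : S ≤ T) :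
    Prim (fun t => Real.exp (f t)) (fun t => φ t * Real.exp (f t)) S T := by
  have h1 := ac_canon (c := f S) hST hf.1
  have h2 : AbsolutelyContinuousOnInterval
      (fun t => Real.exp (f S + ∫ s in S..t, φ s)) S T := by
    obtain ⟨B, hB⟩ := h1.exists_bound
    have hl : ∀ x ∈ uIcc S T, ∀ y ∈ uIcc S T,
        dist (Real.exp (f S + ∫ s in S..x, φ s)) (Real.exp (f S + ∫ s in S..y, φ s)) ≤
        Real.exp B * dist (f S + ∫ s in S..x, φ s) (f S + ∫ s in S..y, φ s) := by
      intro x hx y hy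
      have hx1 := (abs_le.1 (hB x hx)).2
      have hy1 := (abs_le.1 (hB y hy)).2
      set p := f S + ∫ s in S..x, φ s
      set q := f S + ∫ s in S..y, φ s
      have key : ∀ p q : ℝ, p ≤ B → q ≤ p → Real.exp p - Real.exp q ≤ Real.exp B * (p - q) := by
        intro p q hp hq
        have h3 : Real.exp q = Real.exp p * Real.exp (q - p) := by
          rw [← Real.exp_add]; ring_nf
        have h4 := Real.add_one_le_exp (q - p)
        have h5 := Real.exp_pos p
        have h6 : Real.exp p ≤ Real.exp B := Real.exp_le_exp.2 hp
        nlinarith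
      rw [Real.dist_eq, Real.dist_eq]
      rcases le_total q p with hpq | hpq
      · rw [abs_of_nonneg (sub_nonneg.2 (Real.exp_le_exp.2 hpq)), abs_of_nonneg (by linarith)]
        exact key p q hx1 hpq
      · rw [abs_sub_comm, abs_sub_comm p q, abs_of_nonneg (sub_nonneg.2 (Real.exp_le_exp.2 hpq)),
          abs_of_nonneg (by linarith)]
        exact key q p hy1 hpq
    rw [absolutelyContinuousOnInterval_iff] at h1 ⊢
    intro ε hε
    obtain ⟨δ, hδ, H⟩ := h1 (ε / Real.exp B) (by positivity)
    refine ⟨δ, hδ, fun E hE1 hE2 => ?_⟩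
    have h4 := H E hE1 hE2
    have hp := Real.exp_pos B
    rw [lt_div_iff₀ hp] at h4
    refine lt_of_le_of_lt ?_ h4
    rw [Finset.sum_mul]
    refine Finset.sum_le_sum fun i hi => ?_
    rw [mul_comm]
    exact hl _ (hE1.1 i hi).1 _ (hE1.1 i hi).2
  have h3 : Prim _ (fun x => φ x * Real.exp (f S + ∫ s in S..x, φ s)) S T :=
    of_ac hST h2 (by
      filter_upwards [hf.ae_deriv] with x hx1 hx
      have := (hx1 hx).exp
      rwa [mul_comm] at this)
  refine (h3.congr ?_ hST).congr_ig ?_ hST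
  · intro t ht; rw [hf.2 t ht]
  · intro t ht; rw [← hf.2 t ht]

lemma add (hf : Prim f φ S T) (hg : Prim g γ S T) (hST : S ≤ T) :
    Prim (fun t => f t + g t) (fun t => φ t + γ t) S T := by
  refine ⟨hf.1.add hg.1, fun t ht => ?_⟩
  rw [intervalIntegral.integral_add (hf.intervalIntegrable le_rfl ht.1 ht.2)
    (hg.intervalIntegrable le_rfl ht.1 ht.2)]
  beta_reduce
  rw [hf.2 t ht, hg.2 t ht]; ring

lemma const_mul (hf : Prim f φ S T) (c : ℝ) :
    Prim (fun t => c * f t) (fun t => c * φ t) S T := by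
  refine ⟨hf.1.const_mul c, fun t ht => ?_⟩
  rw [intervalIntegral.integral_const_mul]
  beta_reduce
  rw [hf.2 t ht]; ring

lemma const (c : ℝ) : Prim (fun _ => c) (fun _ => 0) S T := by
  refine ⟨intervalIntegrable_const, fun t ht => by simp⟩

lemma neg (hf : Prim f φ S T) : Prim (fun t => - f t) (fun t => - φ t) S T := by
  simpa using hf.const_mul (-1)

lemma sub (hf : Prim f φ S T) (hg : Prim g γ S T) (hST : S ≤ T) :
    Prim (fun t => f t - g t) (fun t => φ t - γ t) S T := by
  simpa [sub_eq_add_neg] using hf.add hg.neg hST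

lemma sum {ι : Type*} (s : Finset ι) {f φ : ι → ℝ → ℝ} (hST : S ≤ T)
    (h : ∀ i ∈ s, Prim (f i) (φ i) S T) :
    Prim (fun t => ∑ i ∈ s, f i t) (fun t => ∑ i ∈ s, φ i t) S T := by
  classical
  induction s using Finset.induction_on with
  | empty => simpa using const (S := S) (T := T) 0
  | insert a s ha ih =>
    simp only [Finset.sum_insert ha]
    exact (h a (by simp)).add (ih fun i hi => h i (by simp [hi])) hST

lemma integral (hφ : IntervalIntegrable φ volume S T) : Prim (fun t => ∫ s in S..t, φ s) φ S T :=
  ⟨hφ, fun t _ => by simp⟩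

/-- Gronwall lower bound. -/
lemma gronwall {w ρ α γ : ℝ → ℝ} (hw : Prim w ρ S T) (hST : S ≤ T)
    (hα : IntervalIntegrable α volume S T) (hγ : IntervalIntegrable γ volume S T)
    (hα0 : ∀ r ∈ Icc S T, 0 ≤ α r) (hγ0 : ∀ r ∈ Icc S T, 0 ≤ γ r)
    (hρ : ∀ r ∈ Icc S T, -(α r * w r) + γ r ≤ ρ r) :
    Real.exp (-∫ r in S..T, α r) * (w S + ∫ r in S..T, γ r) ≤ w T := by
  have hE := (integral hα).exp hST
  have hP := hE.mul hw hST
  have h1 := hP.2 T ⟨hST, le_rfl⟩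
  simp only [intervalIntegral.integral_same, Real.exp_zero, one_mul] at h1
  have h2 : ∫ r in S..T, γ r ≤ ∫ r in S..T, (α r * Real.exp (∫ s in S..r, α s) * w r
      + Real.exp (∫ s in S..r, α s) * ρ r) := by
    refine intervalIntegral.integral_mono_on hST hγ hP.1 fun r hr => ?_
    have h3 : 0 ≤ ∫ s in S..r, α s :=
      intervalIntegral.integral_nonneg hr.1 fun s hs => hα0 s ⟨hs.1, hs.2.trans hr.2⟩
    have h4 : 1 ≤ Real.exp (∫ s in S..r, α s) := Real.one_le_exp h3
    have h5 := hρ r hr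
    have h6 := hγ0 r hr
    nlinarith
  have h7 : w S + ∫ r in S..T, γ r ≤ Real.exp (∫ r in S..T, α r) * w T := by rw [h1]; linarith
  calc _ ≤ Real.exp (-∫ r in S..T, α r) * (Real.exp (∫ r in S..T, α r) * w T) := by gcongr
    _ = w T := by rw [← mul_assoc, ← Real.exp_add]; simp

/-- Maximum principle (positivity). -/
lemma positivity_principle {ι : Type*} [Finite ι] {D ρ α : ι → ℝ → ℝ} (hST : S ≤ T)
    (hD : ∀ i, Prim (D i) (ρ i) S T) (hα : ∀ i, IntervalIntegrable (α i) volume S T)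
    (hα0 : ∀ i, ∀ r ∈ Icc S T, 0 ≤ α i r) (h0 : ∀ i, 0 ≤ D i S)
    (H : ∀ μ : ℝ, 0 ≤ μ → (∀ j, ∀ r ∈ Icc S T, -μ ≤ D j r) →
      ∀ i, ∀ r ∈ Icc S T, -(α i r * (D i r + μ)) ≤ ρ i r) :
    ∀ i, ∀ t ∈ Icc S T, 0 ≤ D i t := by
  intro i t ht
  by_contra hneg
  push Not at hneg
  have : Nonempty ι := ⟨i⟩
  have hmin : ∀ j, ∃ r ∈ Icc S T, ∀ r' ∈ Icc S T, D j r ≤ D j r' := fun j => by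
    obtain ⟨r, hr, h⟩ := isCompact_Icc.exists_isMinOn ⟨S, le_rfl, hST⟩ ((hD j).continuousOn hST)
    exact ⟨r, hr, fun r' hr' => h hr'⟩
  choose r hr hrm using hmin
  obtain ⟨j, hj⟩ := Finite.exists_min (fun j => D j (r j))
  have hle : ∀ k, ∀ r' ∈ Icc S T, D j (r j) ≤ D k r' := fun k r' hr' => (hj k).trans (hrm k r' hr')
  set μ := - D j (r j) with hμ
  have hμ0 : 0 < μ := by have := hle i t ht; linarith
  have HH := H μ hμ0.le (fun k r' hr' => by have := hle k r' hr'; linarith) j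
  have hw : Prim (fun t => D j t + μ) (ρ j) S (r j) := by
    have := (((hD j).add (const (S := S) (T := T) μ) hST)).mono le_rfl (hr j).1 (hr j).2
    simpa using this
  have hg := hw.gronwall (γ := fun _ => 0) (hr j).1
    ((hα j).mono_set (by
      rw [uIcc_of_le (hr j).1, uIcc_of_le hST]; exact Icc_subset_Icc le_rfl (hr j).2))
    intervalIntegrable_const (fun s hs => hα0 j s ⟨hs.1, hs.2.trans (hr j).2⟩)
    (fun _ _ => le_rfl) (fun s hs => by simpa using HH s ⟨hs.1, hs.2.trans (hr j).2⟩)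
  have h1 : 0 < Real.exp (-∫ s in S..(r j), α j s) * (D j S + μ + ∫ s in S..(r j), (0:ℝ)) := by
    simp only [intervalIntegral.integral_zero, add_zero]
    have := h0 j
    positivity
  have : D j (r j) + μ = 0 := by rw [hμ]; ring
  linarith

end Prim

lemma ii_sum {ι : Type*} (s : Finset ι) {f : ι → ℝ → ℝ} {S T : ℝ}
    (h : ∀ i ∈ s, IntervalIntegrable (f i) volume S T) :
    IntervalIntegrable (fun t => ∑ i ∈ s, f i t) volume S T := by
  classical
  induction s using Finset.induction_on with
  | empty => simpa using (intervalIntegrable_const (μ := volume) (a := S) (b := T) (c := (0:ℝ)))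
  | insert k s hk ih =>
    have h1 := h k (Finset.mem_insert_self _ _)
    have h2 := ih fun i hi => h i (Finset.mem_insert_of_mem hi)
    refine (h1.add h2).congr (fun t _ => ?_)
    simp [Finset.sum_insert hk]

/-- Normalised weights and delays. -/
structure Core (b h : V → V → ℝ → ℝ) (hbar : ℝ) : Prop where
  hbar0 : 0 ≤ hbar
  bm : ∀ i j, Measurable (b i j)
  b0 : ∀ i j s, 0 ≤ b i j s
  bi : ∀ i j s t, IntervalIntegrable (b i j) volume s t
  hm : ∀ i j, Measurable (h i j)
  h0 : ∀ i j s, 0 ≤ h i j s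
  h1 : ∀ i j s, h i j s ≤ hbar

/-- Full right-hand side. -/
def FF (b h : V → V → ℝ → ℝ) (x : ℝ → V → ℝ) (i : V) (s : ℝ) : ℝ :=
  ∑ j, b i j s * (x (s - h i j s) j - x s i)

/-- Total incoming weight. -/
def AA (b : V → V → ℝ → ℝ) (i : V) (s : ℝ) : ℝ := ∑ j, b i j s

namespace Core
variable {b h : V → V → ℝ → ℝ} {hbar : ℝ}

lemma int_mul (hc : Core b h hbar) (i j : V) {z : ℝ → ℝ} (hz : Measurable z) {B : ℝ}
    (hB : ∀ s, |z s| ≤ B) (s t : ℝ) : IntervalIntegrable (fun r => b i j r * z r) volume s t := by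
  have h1 := hc.bi i j s t
  rw [intervalIntegrable_iff] at h1 ⊢
  exact h1.mul_bdd (c := B) hz.aestronglyMeasurable (Eventually.of_forall hB)

lemma AA_int (hc : Core b h hbar) (i : V) (s t : ℝ) : IntervalIntegrable (AA b i) volume s t := by
  exact ii_sum Finset.univ (f := fun j => b i j) (fun j _ => hc.bi i j s t)

lemma AA_nonneg (hc : Core b h hbar) (i : V) (s : ℝ) : 0 ≤ AA b i s :=
  Finset.sum_nonneg fun j _ => hc.b0 i j s

end Core

/-- Primitive of the total weight. -/
noncomputable def AI (b : V → V → ℝ → ℝ) (T : ℝ) (i : V) (t : ℝ) : ℝ := ∫ s in T..t, AA b i s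

/-- Monotone iteration. -/
noncomputable def picard (b h : V → V → ℝ → ℝ) (T : ℝ) (ξ η : V → ℝ) : ℕ → ℝ → V → ℝ
  | 0 => fun t i => if t < T then ξ i else if t = T then η i else 0
  | k+1 => fun t i => if t < T then ξ i else
      Real.exp (-AI b T i t) * (η i + ∫ s in T..t, Real.exp (AI b T i s) *
        ∑ j, b i j s * picard b h T ξ η k (s - h i j s) j)

namespace Core
variable {b h : V → V → ℝ → ℝ} {hbar : ℝ}

lemma AI_cont (hc : Core b h hbar) (T : ℝ) (i : V) : Continuous (AI b T i) :=
  intervalIntegral.continuous_primitive (fun s t => hc.AA_int i s t) T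

lemma ig_int (hc : Core b h hbar) (T : ℝ) (i : V) {z : ℝ → V → ℝ}
    (hz : ∀ j, Measurable fun t => z t j) {B : ℝ} (hB : ∀ t j, |z t j| ≤ B) (s t : ℝ) :
    IntervalIntegrable (fun s => Real.exp (AI b T i s) *
        ∑ j, b i j s * z (s - h i j s) j) volume s t := by
  refine IntervalIntegrable.continuousOn_mul ?_ (Real.continuous_exp.comp (hc.AI_cont T i)).continuousOn
  exact ii_sum Finset.univ (f := fun j r => b i j r * z (r - h i j r) j) (fun j _ => hc.int_mul i j
      ((hz j).comp (measurable_id.sub (hc.hm i j))) (fun r => hB _ _) s t)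

lemma exp_int_eq (hc : Core b h hbar) {T t : ℝ} (ht : T ≤ t) (i : V) :
    ∫ s in T..t, Real.exp (AI b T i s) * AA b i s = Real.exp (AI b T i t) - 1 := by
  have := ((Prim.integral (hc.AA_int i T t)).exp ht).2 t ⟨ht, le_rfl⟩
  simp only [intervalIntegral.integral_same, Real.exp_zero] at this
  simp only [AI]
  rw [this]
  simp [mul_comm]

lemma picard_props (hc : Core b h hbar) (T : ℝ) {ξ η : V → ℝ} (hξ0 : ∀ i, 0 ≤ ξ i)
    (hξ1 : ∀ i, ξ i ≤ 1) (hη0 : ∀ i, 0 ≤ η i) (hη1 : ∀ i, η i ≤ 1) (k : ℕ) :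
    (∀ i, Measurable fun t => picard b h T ξ η k t i) ∧
    (∀ t i, 0 ≤ picard b h T ξ η k t i) ∧ (∀ t i, picard b h T ξ η k t i ≤ 1) := by
  induction k with
  | zero =>
    refine ⟨fun i => ?_, fun t i => ?_, fun t i => ?_⟩
    · simp only [picard]
      refine Measurable.ite measurableSet_Iio measurable_const
        (Measurable.ite (measurableSet_singleton T) measurable_const measurable_const)
    · simp only [picard]; split_ifs <;> simp [hξ0, hη0]
    · simp only [picard]; split_ifs <;> simp [hξ1, hη1]
  | succ k ih =>
    obtain ⟨ihm, ih0, ih1⟩ := ih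
    have hab : ∀ t j, |picard b h T ξ η k t j| ≤ 1 := fun t j => by
      rw [abs_of_nonneg (ih0 t j)]; exact ih1 t j
    refine ⟨fun i => ?_, fun t i => ?_, fun t i => ?_⟩
    · simp only [picard]
      refine Measurable.ite measurableSet_Iio measurable_const ?_
      refine Continuous.measurable ?_
      refine (Real.continuous_exp.comp (hc.AI_cont T i).neg).mul (continuous_const.add ?_)
      exact intervalIntegral.continuous_primitive (fun s t => hc.ig_int T i ihm hab s t) T
    · simp only [picard]; split_ifs with ht
      · exact hξ0 i
      · refine mul_nonneg (Real.exp_pos _).le (add_nonneg (hη0 i) ?_)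
        refine intervalIntegral.integral_nonneg (not_lt.1 ht) fun s _ => ?_
        exact mul_nonneg (Real.exp_pos _).le (Finset.sum_nonneg fun j _ =>
          mul_nonneg (hc.b0 i j s) (ih0 _ _))
    · simp only [picard]; split_ifs with ht
      · exact hξ1 i
      · have ht' := not_lt.1 ht
        have h1 : ∫ s in T..t, Real.exp (AI b T i s) *
            ∑ j, b i j s * picard b h T ξ η k (s - h i j s) j ≤
            ∫ s in T..t, Real.exp (AI b T i s) * AA b i s := by
          refine intervalIntegral.integral_mono_on ht' (hc.ig_int T i ihm hab T t) ?_ fun s _ => ?_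
          · exact (hc.AA_int i T t).continuousOn_mul
              (Real.continuous_exp.comp (hc.AI_cont T i)).continuousOn
          · refine mul_le_mul_of_nonneg_left ?_ (Real.exp_pos _).le
            refine Finset.sum_le_sum fun j _ => ?_
            exact mul_le_of_le_one_right (hc.b0 i j s) (ih1 _ _)
        rw [hc.exp_int_eq ht' i] at h1
        calc _ ≤ Real.exp (-AI b T i t) * Real.exp (AI b T i t) := by
              refine mul_le_mul_of_nonneg_left ?_ (Real.exp_pos _).le
              linarith [hη1 i]
          _ = 1 := by rw [← Real.exp_add]; simp

lemma picard_mono (hc : Core b h hbar) (T : ℝ) {ξ η : V → ℝ} (hξ0 : ∀ i, 0 ≤ ξ i)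
    (hξ1 : ∀ i, ξ i ≤ 1) (hη0 : ∀ i, 0 ≤ η i) (hη1 : ∀ i, η i ≤ 1) (k : ℕ) :
    ∀ t i, picard b h T ξ η k t i ≤ picard b h T ξ η (k+1) t i := by
  have P := fun k => hc.picard_props T hξ0 hξ1 hη0 hη1 k
  have hab : ∀ k t j, |picard b h T ξ η k t j| ≤ 1 := fun k t j => by
      rw [abs_of_nonneg ((P k).2.1 t j)]; exact (P k).2.2 t j
  induction k with
  | zero =>
    intro t i
    by_cases ht : t < T
    · simp [picard, ht]
    · by_cases ht2 : t = T
      · subst ht2; simp [picard, AI]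
      · have := (P 1).2.1 t i
        simpa [picard, ht, ht2] using this
  | succ k ih =>
    intro t i
    by_cases ht : t < T
    · simp [picard, ht]
    · have ht' := not_lt.1 ht
      rw [picard, picard]
      simp only [ht, if_false]
      refine mul_le_mul_of_nonneg_left ?_ (Real.exp_pos _).le
      gcongr
      refine intervalIntegral.integral_mono_on ht' (hc.ig_int T i (P k).1 (hab k) T t)
        (hc.ig_int T i (P (k+1)).1 (hab (k+1)) T t) fun s _ => ?_
      refine mul_le_mul_of_nonneg_left ?_ (Real.exp_pos _).le
      refine Finset.sum_le_sum fun j _ => ?_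
      exact mul_le_mul_of_nonneg_left (ih _ _) (hc.b0 i j s)

/-- Existence of solutions with history `ξ` and initial value `η`. -/
lemma exists_sol (hc : Core b h hbar) (T : ℝ) {ξ η : V → ℝ} (hξ0 : ∀ i, 0 ≤ ξ i)
    (hξ1 : ∀ i, ξ i ≤ 1) (hη0 : ∀ i, 0 ≤ η i) (hη1 : ∀ i, η i ≤ 1) :
    ∃ y : ℝ → V → ℝ, (∀ i, Measurable fun t => y t i) ∧ (∀ t i, 0 ≤ y t i) ∧
      (∀ t i, y t i ≤ 1) ∧ (∀ t < T, ∀ i, y t i = ξ i) ∧ (∀ i, y T i = η i) ∧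
      ∀ i, ∀ T' ≥ T, Prim (fun t => y t i) (FF b h y i) T T' := by
  have P := fun k => hc.picard_props T hξ0 hξ1 hη0 hη1 k
  have Mo := fun k => hc.picard_mono T hξ0 hξ1 hη0 hη1 k
  have hab : ∀ k t j, |picard b h T ξ η k t j| ≤ 1 := fun k t j => by
      rw [abs_of_nonneg ((P k).2.1 t j)]; exact (P k).2.2 t j
  have hlim : ∀ t i, ∃ y, Tendsto (fun k => picard b h T ξ η k t i) atTop (𝓝 y) := by
    intro t i
    exact ⟨_, tendsto_atTop_ciSup (monotone_nat_of_le_succ fun k => Mo k t i)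
      ⟨1, by rintro _ ⟨k, rfl⟩; exact (P k).2.2 t i⟩⟩
  choose y hy using hlim
  have hym : ∀ i, Measurable fun t => y t i := fun i =>
    measurable_of_tendsto_metrizable (fun k => (P k).1 i)
      (tendsto_pi_nhds.2 fun t => hy t i)
  have hy0 : ∀ t i, 0 ≤ y t i := fun t i => ge_of_tendsto' (hy t i) fun k => (P k).2.1 t i
  have hy1 : ∀ t i, y t i ≤ 1 := fun t i => le_of_tendsto' (hy t i) fun k => (P k).2.2 t i
  have hyab : ∀ t j, |y t j| ≤ 1 := fun t j => by
      rw [abs_of_nonneg (hy0 t j)]; exact hy1 t j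
  have hfix : ∀ t ≥ T, ∀ i, y t i = Real.exp (-AI b T i t) * (η i +
      ∫ s in T..t, Real.exp (AI b T i s) * ∑ j, b i j s * y (s - h i j s) j) := by
    intro t ht i
    have h1 : Tendsto (fun k => picard b h T ξ η (k+1) t i) atTop (𝓝 (y t i)) :=
      (hy t i).comp (tendsto_add_atTop_nat 1)
    have h2 : Tendsto (fun k => ∫ s in T..t, Real.exp (AI b T i s) *
        ∑ j, b i j s * picard b h T ξ η k (s - h i j s) j) atTop
        (𝓝 (∫ s in T..t, Real.exp (AI b T i s) * ∑ j, b i j s * y (s - h i j s) j)) := by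
      refine intervalIntegral.tendsto_integral_filter_of_dominated_convergence
        (fun s => Real.exp (AI b T i s) * AA b i s) ?_ ?_ ?_ ?_
      · refine Eventually.of_forall fun k => ?_
        exact (intervalIntegrable_iff.1 (hc.ig_int T i (P k).1 (hab k) T t)).aestronglyMeasurable
      · refine Eventually.of_forall fun k => Eventually.of_forall fun s _ => ?_
        rw [Real.norm_of_nonneg (mul_nonneg (Real.exp_pos _).le (Finset.sum_nonneg fun j _ =>
          mul_nonneg (hc.b0 i j s) ((P k).2.1 _ _)))]
        refine mul_le_mul_of_nonneg_left ?_ (Real.exp_pos _).le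
        refine Finset.sum_le_sum fun j _ => ?_
        exact mul_le_of_le_one_right (hc.b0 i j s) ((P k).2.2 _ _)
      · exact (hc.AA_int i T t).continuousOn_mul
              (Real.continuous_exp.comp (hc.AI_cont T i)).continuousOn
      · refine Eventually.of_forall fun s _ => ?_
        refine Tendsto.const_mul _ (tendsto_finsetSum _ fun j _ => ?_)
        exact (hy _ j).const_mul _
    refine tendsto_nhds_unique h1 ?_
    have h3 : ∀ k, picard b h T ξ η (k+1) t i = Real.exp (-AI b T i t) * (η i +
      ∫ s in T..t, Real.exp (AI b T i s) *
        ∑ j, b i j s * picard b h T ξ η k (s - h i j s) j) := by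
      intro k; rw [picard]; simp [not_lt.2 ht]
    simp only [h3]
    exact (h2.const_add _).const_mul _
  refine ⟨y, hym, hy0, hy1, fun t ht i => ?_, fun i => ?_, fun i T' hT' => ?_⟩
  · refine tendsto_nhds_unique (hy t i) ?_
    refine tendsto_const_nhds.congr fun k => ?_
    cases k <;> simp [picard, ht]
  · have := hfix T le_rfl i
    simpa [AI] using this
  · have hE := ((Prim.integral (hc.AA_int i T T')).neg).exp hT'
    have hI := (Prim.const (S := T) (T := T') (η i)).add
      (Prim.integral (hc.ig_int T i hym hyab T T')) hT'
    have hP := hE.mul hI hT'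
    refine (hP.congr ?_ hT').congr_ig ?_ hT'
    · intro t ht
      exact hfix t ht.1 i
    · intro t ht
      have h1 := hfix t ht.1 i
      have h2 : Real.exp (-AI b T i t) * Real.exp (AI b T i t) = 1 := by
        rw [← Real.exp_add]; simp
      have h3 : FF b h y i t = (∑ j, b i j t * y (t - h i j t) j) - AA b i t * y t i := by
        simp only [FF, AA, mul_sub, Finset.sum_sub_distrib, Finset.sum_mul]
      rw [h3]
      change _ = -AA b i t * Real.exp (-AI b T i t) * (η i +
        ∫ s in T..t, Real.exp (AI b T i s) * ∑ j, b i j s * y (s - h i j s) j) +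
        Real.exp (-AI b T i t) * (0 + Real.exp (AI b T i t) * ∑ j, b i j t * y (t - h i j t) j)
      rw [mul_assoc (-AA b i t), ← h1, zero_add, ← mul_assoc (Real.exp _), h2]
      ring

end Core

namespace Core
variable {b h : V → V → ℝ → ℝ} {hbar : ℝ}

/-- Maximum principle for a group of agents `U` with leak `f`. -/
lemma setMP (hc : Core b h hbar) (U : Finset V) {x ρ : ℝ → V → ℝ} {T t1 θ : ℝ} (hT : T ≤ t1)
    (hx : ∀ i ∈ U, Prim (fun t => x t i) (fun t => ρ t i) T t1) {f : ℝ → ℝ}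
    (hf : IntervalIntegrable f volume T t1) (hf0 : ∀ s ∈ Icc T t1, 0 ≤ f s)
    (h0 : ∀ j ∈ U, ∀ r ∈ Icc (T - hbar) T, θ ≤ x r j)
    (hρ : ∀ i ∈ U, ∀ s ∈ Icc T t1,
      ∑ j ∈ U, b i j s * (x (s - h i j s) j - x s i) - f s ≤ ρ s i) :
    ∀ i ∈ U, ∀ t ∈ Icc T t1, θ - ∫ s in T..t, f s ≤ x t i := by
  have hFm : ∀ r ∈ Icc T t1, ∀ s ∈ Icc T t1, r ≤ s → ∫ v in T..r, f v ≤ ∫ v in T..s, f v := by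
    intro r hr s hs hrs
    have h1 : IntervalIntegrable f volume T r := hf.mono_set (by
      rw [uIcc_of_le hr.1, uIcc_of_le hT]; exact Icc_subset_Icc le_rfl hr.2)
    have h2 : IntervalIntegrable f volume r s := hf.mono_set (by
      rw [uIcc_of_le hrs, uIcc_of_le hT]; exact Icc_subset_Icc hr.1 hs.2)
    rw [← intervalIntegral.integral_add_adjacent_intervals h1 h2]
    have := intervalIntegral.integral_nonneg (μ := volume) hrs
      (fun u hu => hf0 u ⟨hr.1.trans hu.1, hu.2.trans hs.2⟩)
    linarith
  have hF0 : ∀ r ∈ Icc T t1, 0 ≤ ∫ v in T..r, f v := fun r hr =>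
    intervalIntegral.integral_nonneg hr.1 (fun u hu => hf0 u ⟨hu.1, hu.2.trans hr.2⟩)
  have key := Prim.positivity_principle (ι := U) (S := T) (T := t1)
    (D := fun i t => (x t i + -θ) + ∫ s in T..t, f s) (ρ := fun i t => (ρ t i + 0) + f t)
    (α := fun i s => ∑ j ∈ U, b i j s) hT
    (fun i => ((hx i i.2).add (Prim.const (-θ)) hT).add (Prim.integral hf) hT)
    (fun i => ii_sum U (fun j _ => hc.bi i j T t1))
    (fun i r _ => Finset.sum_nonneg fun j _ => hc.b0 i j r)
    (fun i => by
      have := h0 i i.2 T ⟨by linarith [hc.hbar0], le_rfl⟩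
      simp only [intervalIntegral.integral_same, add_zero]; linarith) ?_
  · intro i hi t ht
    have := key ⟨i, hi⟩ t ht
    simp only at this
    linarith
  · intro μ hμ hm i r hr
    have h1 := hρ i i.2 r hr
    have h2 : -((∑ j ∈ U, b i j r) * (x r i + -θ + (∫ s in T..r, f s) + μ)) ≤
        ∑ j ∈ U, b i j r * (x (r - h i j r) j - x r i) := by
      rw [Finset.sum_mul, ← Finset.sum_neg_distrib]
      refine Finset.sum_le_sum fun j hj => ?_
      have hb := hc.b0 i j r
      have hh0 := hc.h0 i j r
      have hh1 := hc.h1 i j r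
      have h3 : θ - (∫ s in T..r, f s) - μ ≤ x (r - h i j r) j := by
        by_cases hlt : r - h i j r ≤ T
        · have h4 := h0 j hj (r - h i j r) ⟨by linarith [hr.1], hlt⟩
          have := hF0 r hr
          linarith
        · have hmem : r - h i j r ∈ Icc T t1 := ⟨by linarith, by linarith [hr.2]⟩
          have h4 := hm ⟨j, hj⟩ _ hmem
          have h5 := hFm _ hmem r hr (by linarith)
          simp only at h4
          linarith
      nlinarith
    linarith

lemma FF_ge (hc : Core b h hbar) {Y : ℝ → V → ℝ} {i : V} {s : ℝ} (U : Finset V) {κ : ℝ}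
    (hY0 : ∀ r ∈ Icc (s - hbar) s, ∀ j, 0 ≤ Y r j) (hκ : ∀ r ∈ Icc (s - hbar) s, ∀ j ∈ U, κ ≤ Y r j) :
    -(AA b i s * Y s i) + κ * ∑ j ∈ U, b i j s ≤ FF b h Y i s := by
  have hmem : ∀ j, s - h i j s ∈ Icc (s - hbar) s := fun j =>
    ⟨by linarith [hc.h1 i j s], by linarith [hc.h0 i j s]⟩
  have h3 : FF b h Y i s = (∑ j, b i j s * Y (s - h i j s) j) - AA b i s * Y s i := by
    simp only [FF, AA, mul_sub, Finset.sum_sub_distrib, Finset.sum_mul]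
  rw [h3]
  have : κ * ∑ j ∈ U, b i j s ≤ ∑ j, b i j s * Y (s - h i j s) j := by
    rw [Finset.mul_sum]
    calc _ ≤ ∑ j ∈ U, b i j s * Y (s - h i j s) j := Finset.sum_le_sum fun j hj => by
            rw [mul_comm]; exact mul_le_mul_of_nonneg_left (hκ _ (hmem j) j hj) (hc.b0 i j s)
      _ ≤ _ := Finset.sum_le_sum_of_subset_of_nonneg (Finset.subset_univ _) fun j _ _ =>
            mul_nonneg (hc.b0 i j s) (hY0 _ (hmem j) j)
  linarith

lemma AA_int_mono (hc : Core b h hbar) {S t T C : ℝ} {i : V} (hSt : S ≤ t) (ht : t ≤ T)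
    (hC : ∫ s in S..T, AA b i s ≤ C) : Real.exp (-C) ≤ Real.exp (-∫ s in S..t, AA b i s) := by
  apply Real.exp_le_exp.2
  have h1 := intervalIntegral.integral_add_adjacent_intervals (hc.AA_int i S t) (hc.AA_int i t T)
  have h2 : 0 ≤ ∫ s in t..T, AA b i s := intervalIntegral.integral_nonneg ht
    (fun u _ => hc.AA_nonneg i u)
  linarith

lemma Y_ge (hc : Core b h hbar) {Y : ℝ → V → ℝ} {S T C : ℝ} {i : V}
    (hP : Prim (fun t => Y t i) (FF b h Y i) S T) (hY0 : ∀ t i, 0 ≤ Y t i)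
    (hC : ∫ s in S..T, AA b i s ≤ C) (h1 : Y S i = 1) :
    ∀ t ∈ Icc S T, Real.exp (-C) ≤ Y t i := by
  intro t ht
  have hg := (hP.mono le_rfl ht.1 ht.2).gronwall (γ := fun _ => 0) ht.1 (hc.AA_int i S t)
    intervalIntegrable_const (fun r _ => hc.AA_nonneg i r) (fun _ _ => le_rfl) (fun r _ => by
      have := hc.FF_ge (Y := Y) (i := i) (s := r) ∅ (κ := 0) (fun r _ j => hY0 r j) (by simp)
      simpa using this)
  have := hc.AA_int_mono ht.1 ht.2 hC
  simp only [h1, intervalIntegral.integral_zero, add_zero, mul_one] at hg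
  linarith

lemma Y_in (hc : Core b h hbar) {Y : ℝ → V → ℝ} {S T C : ℝ} {i : V} (hST : S ≤ T) (U : Finset V)
    (hP : Prim (fun t => Y t i) (FF b h Y i) S T) (hY0 : ∀ t i, 0 ≤ Y t i)
    (hC : ∫ s in S..T, AA b i s ≤ C)
    (hU : ∀ j ∈ U, ∀ t ∈ Icc (S - hbar) T, Real.exp (-C) ≤ Y t j) :
    Real.exp (-C)^2 * ∫ s in S..T, ∑ j ∈ U, b i j s ≤ Y T i := by
  have hb0 : ∀ r, 0 ≤ ∑ j ∈ U, b i j r := fun r => Finset.sum_nonneg fun j _ => hc.b0 i j r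
  have hg := hP.gronwall (γ := fun s => Real.exp (-C) * ∑ j ∈ U, b i j s) hST (hc.AA_int i S T)
    ((ii_sum U fun j _ => hc.bi i j S T).const_mul _) (fun r _ => hc.AA_nonneg i r)
    (fun r _ => mul_nonneg (Real.exp_pos _).le (hb0 r)) (fun r hr =>
      hc.FF_ge (Y := Y) (i := i) (s := r) U (fun r _ j => hY0 r j)
        (fun r' hr' j hj => hU j hj r' ⟨by linarith [hr'.1, hr.1], hr'.2.trans hr.2⟩))
  rw [intervalIntegral.integral_const_mul] at hg
  have h1 := hc.AA_int_mono hST le_rfl hC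
  have h2 : 0 ≤ ∫ s in S..T, ∑ j ∈ U, b i j s :=
    intervalIntegral.integral_nonneg hST fun u _ => hb0 u
  refine le_trans ?_ hg
  have h3 := hY0 S i
  have h4 := Real.exp_pos (-C)
  rw [pow_two, mul_assoc]
  refine mul_le_mul h1 (by linarith) (by positivity) (Real.exp_pos _).le

end Core

/-- The dual cone-polyhedron used as a Lyapunov certificate. -/
def InQ (Γ ρ : ℝ) (qm qe : V → ℝ) : Prop :=
  (∀ i, 0 ≤ qm i) ∧ (∀ i, 0 ≤ qe i) ∧ ∀ M E : Finset V, M ⊆ E → E.Nonempty →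
    Γ ^ M.card + ρ * Γ ^ E.card ≤ ∑ i ∈ M, qm i + ∑ i ∈ E, qe i

lemma crunch {K c : ℝ} (hK : 1 ≤ K) (hc0 : 0 < c) (hc1 : c ≤ 1) {qm qe : V → ℝ}
    (hq : InQ (8 * K / c ^ 4) (c / 2) qm qe) {Ys YT : V → ℝ} (hs0 : ∀ i, 0 ≤ Ys i)
    (hT0 : ∀ i, 0 ≤ YT i) {M E : Finset V} (hME : M ⊆ E) (hE : E.Nonempty)
    (hsE : ∀ i ∈ E, c ≤ Ys i) (hTE : ∀ i ∈ E, c ≤ YT i)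
    (hU : M = E → ∃ w : V → ℝ, ∃ W : ℝ, 0 ≤ W ∧ (∀ i, 0 ≤ w i) ∧ (∀ i ∈ E, 1 - W ≤ Ys i) ∧
      (∀ i ∈ E, 1 - W ≤ YT i) ∧ (∀ i ∈ Eᶜ, c ^ 2 * w i ≤ YT i) ∧ W ≤ K * ∑ i ∈ Eᶜ, w i) :
    (8 * K / c ^ 4) ^ M.card + c / 2 * (8 * K / c ^ 4) ^ E.card ≤
      ∑ i, (qm i * Ys i + qe i * YT i) := by
  obtain ⟨hm0, he0, hQ⟩ := hq
  set Γ := 8 * K / c ^ 4 with hΓ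
  have hK0 : 0 < K := by linarith
  have hΓ8 : 8 / c ≤ Γ := by
    rw [hΓ, div_le_div_iff₀ hc0 (by positivity)]
    have : c ^ 4 ≤ c := by
      calc c ^ 4 ≤ c ^ 1 := pow_le_pow_of_le_one hc0.le hc1 (by norm_num)
        _ = c := pow_one c
    nlinarith
  have hcΓ : 8 ≤ c * Γ := by
    rw [div_le_iff₀ hc0] at hΓ8; linarith
  have hΓ1 : 1 ≤ Γ := by nlinarith
  have hΓ0 : 0 < Γ := by linarith
  have hX := hQ E E (le_refl _) hE
  have hterm : ∀ i, 0 ≤ qm i * Ys i + qe i * YT i := fun i =>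
    add_nonneg (mul_nonneg (hm0 i) (hs0 i)) (mul_nonneg (he0 i) (hT0 i))
  set X := ∑ i ∈ E, qm i + ∑ i ∈ E, qe i with hXdef
  have hval1 : ∀ z : ℝ, (∀ i ∈ E, z ≤ Ys i) → (∀ i ∈ E, z ≤ YT i) →
      z * X ≤ ∑ i ∈ E, (qm i * Ys i + qe i * YT i) := by
    intro z h1 h2
    rw [hXdef, ← Finset.sum_add_distrib, Finset.mul_sum]
    refine Finset.sum_le_sum fun i hi => ?_
    have := mul_le_mul_of_nonneg_left (h1 i hi) (hm0 i)
    have := mul_le_mul_of_nonneg_left (h2 i hi) (he0 i)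
    linarith
  have hsplit : ∑ i, (qm i * Ys i + qe i * YT i) = ∑ i ∈ E, (qm i * Ys i + qe i * YT i) +
      ∑ i ∈ Eᶜ, (qm i * Ys i + qe i * YT i) := (Finset.sum_add_sum_compl E _).symm
  have hcompl0 : 0 ≤ ∑ i ∈ Eᶜ, (qm i * Ys i + qe i * YT i) := Finset.sum_nonneg fun i _ => hterm i
  have hcX := hval1 c hsE hTE
  have hpm : 0 < Γ ^ M.card := by positivity
  by_cases hne : M = E
  · subst hne
    obtain ⟨w, W, hW0, hw0, hs, hT, hout, hWw⟩ := hU rfl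
    set X0 := Γ ^ M.card + c / 2 * Γ ^ M.card with hX0
    have hX00 : 0 < X0 := by positivity
    by_cases hbig : X0 ≤ c * X
    · linarith
    push Not at hbig
    have hXlt : X < X0 / c := by rw [lt_div_iff₀ hc0]; linarith
    have hqe : ∀ i ∈ Mᶜ, K * X0 / c ^ 3 ≤ qe i := by
      intro i hi
      have hi' : i ∉ M := by simpa using hi
      have h1 := hQ M (insert i M) (Finset.subset_insert _ _) (Finset.insert_nonempty _ _)
      rw [Finset.sum_insert hi', Finset.card_insert_of_notMem hi'] at h1
      have h2 : c / 2 * Γ ^ (M.card + 1) = 4 * K / c ^ 3 * Γ ^ M.card := by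
        rw [pow_succ, hΓ]; field_simp; ring
      rw [h2] at h1
      have h3 : X0 / c ≤ K * X0 / c ^ 3 := by
        rw [div_le_div_iff₀ hc0 (by positivity)]
        have : c ^ 3 ≤ c := by
          calc c ^ 3 ≤ c ^ 1 := pow_le_pow_of_le_one hc0.le hc1 (by norm_num)
            _ = c := pow_one c
        nlinarith [mul_le_mul_of_nonneg_left this hX00.le, mul_nonneg (mul_nonneg (sub_nonneg.2 hK) hX00.le) hc0.le]
      have h4 : K * X0 / c ^ 3 ≤ 2 * K / c ^ 3 * Γ ^ M.card := by
        rw [div_mul_eq_mul_div]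
        refine div_le_div_of_nonneg_right ?_ (by positivity)
        rw [hX0]
        nlinarith [mul_pos hK0 hpm]
      have h5 : 4 * K / c ^ 3 * Γ ^ M.card = 2 * (2 * K / c ^ 3 * Γ ^ M.card) := by ring
      linarith
    have hc1' := hval1 (1 - W) hs hT
    have hout2 : W * (X0 / c) ≤ ∑ i ∈ Mᶜ, (qm i * Ys i + qe i * YT i) := by
      calc W * (X0 / c) ≤ (K * ∑ i ∈ Mᶜ, w i) * (X0 / c) :=
            mul_le_mul_of_nonneg_right hWw (by positivity)
        _ = ∑ i ∈ Mᶜ, (K * X0 / c ^ 3) * (c ^ 2 * w i) := by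
            rw [← Finset.mul_sum, ← Finset.mul_sum]; field_simp
        _ ≤ _ := Finset.sum_le_sum fun i hi => by
            have h1 := hqe i hi
            have h2 := hout i hi
            have h3 := mul_le_mul h1 h2 (by have := hw0 i; positivity) (he0 i)
            have := mul_nonneg (hm0 i) (hs0 i)
            linarith
    have h6 : W * X ≤ W * (X0 / c) := mul_le_mul_of_nonneg_left hXlt.le hW0
    nlinarith
  · have hlt : M.card < E.card := Finset.card_lt_card (hME.ssubset_of_ne hne)
    have h1 : Γ ^ (M.card + 1) ≤ Γ ^ E.card := pow_le_pow_right₀ hΓ1 hlt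
    rw [pow_succ] at h1
    have h2 : c * (Γ ^ E.card + c / 2 * Γ ^ E.card) ≤ c * X := mul_le_mul_of_nonneg_left hX hc0.le
    have h3 : 0 < Γ ^ E.card := by positivity
    have h4 : Γ ^ M.card * 8 ≤ c * Γ ^ E.card := by nlinarith
    have h5 : 0 ≤ c * (c / 2 * Γ ^ E.card) := by positivity
    linarith

/-- A time block `[S,T]`. -/
structure Blk (b : V → V → ℝ → ℝ) (hbar C K S T : ℝ) : Prop where
  len : S + hbar ≤ T
  hC : ∀ i, ∫ s in S..T, AA b i s ≤ C
  sym : ∀ i j, ∫ s in S..T, b i j s ≤ K * ∫ s in S..T, b j i s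

/-- Combination of basis solutions. -/
def Yc (ym ye : V → ℝ → V → ℝ) (p q : V → ℝ) (t : ℝ) (i : V) : ℝ :=
  ∑ k, (p k * ym k t i + q k * ye k t i)

lemma FF_Yc (b h : V → V → ℝ → ℝ) (ym ye : V → ℝ → V → ℝ) (p q : V → ℝ) (i : V) (s : ℝ) :
    FF b h (Yc ym ye p q) i s = ∑ k, (p k * FF b h (ym k) i s + q k * FF b h (ye k) i s) := by
  simp only [FF, Yc, Finset.mul_sum, ← Finset.sum_sub_distrib, ← Finset.sum_add_distrib]
  rw [Finset.sum_comm]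
  refine Finset.sum_congr rfl fun k _ => Finset.sum_congr rfl fun j _ => ?_
  ring

namespace Core
variable {b h : V → V → ℝ → ℝ} {hbar : ℝ}

lemma exists_basis (hc : Core b h hbar) (S : ℝ) : ∃ ym ye : V → ℝ → V → ℝ,
    (∀ k t i, 0 ≤ ym k t i) ∧ (∀ k t i, 0 ≤ ye k t i) ∧ ∀ p q : V → ℝ,
      (∀ t < S, ∀ i, Yc ym ye p q t i = p i) ∧ (∀ i, Yc ym ye p q S i = q i) ∧
      ∀ i, ∀ T ≥ S, Prim (fun t => Yc ym ye p q t i) (FF b h (Yc ym ye p q) i) S T := by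
  have d0 : ∀ k i : V, (0:ℝ) ≤ if k = i then 1 else 0 := fun k i => by split_ifs <;> norm_num
  have d1 : ∀ k i : V, (if k = i then (1:ℝ) else 0) ≤ 1 := fun k i => by split_ifs <;> norm_num
  have H1 := fun k : V => hc.exists_sol S (ξ := fun i => if k = i then 1 else 0) (η := fun _ => 0)
    (d0 k) (d1 k) (by simp) (by simp)
  have H2 := fun k : V => hc.exists_sol S (η := fun i => if k = i then 1 else 0) (ξ := fun _ => 0)
    (by simp) (by simp) (d0 k) (d1 k)
  choose ym _ hm0 _ hmξ hmη hmP using H1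
  choose ye _ he0 _ heξ heη heP using H2
  refine ⟨ym, ye, hm0, he0, fun p q => ⟨fun t ht i => ?_, fun i => ?_, fun i T hT => ?_⟩⟩
  · simp [Yc, hmξ _ t ht, heξ _ t ht]
  · simp [Yc, hmη, heη]
  · have := Prim.sum Finset.univ hT (f := fun k t => p k * ym k t i + q k * ye k t i)
      (φ := fun k t => p k * FF b h (ym k) i t + q k * FF b h (ye k) i t)
      (fun k _ => ((hmP k i T hT).const_mul (p k)).add ((heP k i T hT).const_mul (q k)) hT)
    exact this.congr_ig (fun t _ => FF_Yc b h ym ye p q i t) hT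

lemma Yc_sum (ym ye : V → ℝ → V → ℝ) (p q qm qe : V → ℝ) (s : V → ℝ) (T : ℝ) :
    ∑ i, (qm i * Yc ym ye p q (s i) i + qe i * Yc ym ye p q T i) =
    ∑ k, ((∑ i, (qm i * ym k (s i) i + qe i * ym k T i)) * p k +
      (∑ i, (qm i * ye k (s i) i + qe i * ye k T i)) * q k) := by
  simp only [Yc, Finset.mul_sum, Finset.sum_mul, ← Finset.sum_add_distrib]
  rw [Finset.sum_comm]
  refine Finset.sum_congr rfl fun k _ => Finset.sum_congr rfl fun j _ => ?_
  ring

lemma transfer (hc : Core b h hbar) {S T C K : ℝ} (hB : Blk b hbar C K S T) (hC0 : 0 ≤ C)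
    (hK : 1 ≤ K) {qm qe : V → ℝ}
    (hq : InQ (8 * K / Real.exp (-C) ^ 4) (Real.exp (-C) / 2) qm qe) {s : V → ℝ}
    (hs : ∀ i, s i ∈ Icc (T - hbar) T) {ym ye : V → ℝ → V → ℝ} (hm0 : ∀ k t i, 0 ≤ ym k t i)
    (he0 : ∀ k t i, 0 ≤ ye k t i) (hY : ∀ p q : V → ℝ,
      (∀ t < S, ∀ i, Yc ym ye p q t i = p i) ∧ (∀ i, Yc ym ye p q S i = q i) ∧
      ∀ i, ∀ T ≥ S, Prim (fun t => Yc ym ye p q t i) (FF b h (Yc ym ye p q) i) S T) :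
    InQ (8 * K / Real.exp (-C) ^ 4) (Real.exp (-C) / 2)
      (fun k => ∑ i, (qm i * ym k (s i) i + qe i * ym k T i))
      (fun k => ∑ i, (qm i * ye k (s i) i + qe i * ye k T i)) := by
  have hST : S ≤ T := by linarith [hB.len, hc.hbar0]
  have hs' : ∀ i, s i ∈ Icc S T := fun i => ⟨by linarith [(hs i).1, hB.len], (hs i).2⟩
  refine ⟨fun k => Finset.sum_nonneg fun i _ => add_nonneg (mul_nonneg (hq.1 i) (hm0 _ _ _))
    (mul_nonneg (hq.2.1 i) (hm0 _ _ _)), fun k => Finset.sum_nonneg fun i _ =>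
    add_nonneg (mul_nonneg (hq.1 i) (he0 _ _ _)) (mul_nonneg (hq.2.1 i) (he0 _ _ _)),
    fun M E hME hE => ?_⟩
  set p : V → ℝ := fun k => if k ∈ M then 1 else 0 with hp
  set q : V → ℝ := fun k => if k ∈ E then 1 else 0 with hqq
  obtain ⟨hYh, hYS, hYP⟩ := hY p q
  set Y := Yc ym ye p q with hYdef
  have hval := Yc_sum ym ye p q qm qe s T
  have hval2 : ∑ k, ((∑ i, (qm i * ym k (s i) i + qe i * ym k T i)) * p k +
      (∑ i, (qm i * ye k (s i) i + qe i * ye k T i)) * q k) =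
      ∑ k ∈ M, (∑ i, (qm i * ym k (s i) i + qe i * ym k T i)) +
      ∑ k ∈ E, (∑ i, (qm i * ye k (s i) i + qe i * ye k T i)) := by
    simp [hp, hqq, Finset.sum_add_distrib]
  rw [← hval2, ← hval]
  have hp0 : ∀ k, 0 ≤ p k := fun k => by simp only [hp]; split_ifs <;> norm_num
  have hq0 : ∀ k, 0 ≤ q k := fun k => by simp only [hqq]; split_ifs <;> norm_num
  have hp1 : ∀ k, p k ≤ 1 := fun k => by simp only [hp]; split_ifs <;> norm_num
  have hq1 : ∀ k, q k ≤ 1 := fun k => by simp only [hqq]; split_ifs <;> norm_num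
  have hY0 : ∀ t i, 0 ≤ Y t i := fun t i => Finset.sum_nonneg fun k _ =>
    add_nonneg (mul_nonneg (hp0 k) (hm0 _ _ _)) (mul_nonneg (hq0 k) (he0 _ _ _))
  have hYE : ∀ i ∈ E, ∀ t ∈ Icc S T, Real.exp (-C) ≤ Y t i := fun i hi =>
    hc.Y_ge (hYP i T hST) hY0 (hB.hC i) (by rw [hYS]; simp [hqq, hi])
  have hc1 : Real.exp (-C) ≤ 1 := Real.exp_le_one_iff.2 (by linarith)
  refine crunch hK (Real.exp_pos _) hc1 hq (fun i => hY0 _ _) (fun i => hY0 _ _) hME hE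
    (fun i hi => hYE i hi _ (hs' i)) (fun i hi => hYE i hi T ⟨hST, le_rfl⟩) ?_
  intro hEq
  have hYle : ∀ t ∈ Icc S T, ∀ i, Y t i ≤ 1 := by
    intro t ht i
    have := hc.setMP Finset.univ (x := fun t i => 1 + -Y t i)
      (ρ := fun t i => 0 + -FF b h Y i t) (θ := 0) (f := fun _ => 0) hST
      (fun i _ => (Prim.const 1).add (hYP i T hST).neg hST) intervalIntegrable_const
      (fun _ _ => le_rfl) (fun j _ r hr => by
        rcases lt_or_eq_of_le hr.2 with h1 | h1
        · rw [hYh r h1 j]; linarith [hp1 j]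
        · rw [h1, hYS]; linarith [hq1 j]) (fun i _ r hr => by
        simp only [FF, sub_zero, zero_add, ← Finset.sum_neg_distrib]
        refine Finset.sum_le_sum fun j _ => le_of_eq ?_
        ring) i (Finset.mem_univ i) t ht
    simp only [intervalIntegral.integral_zero] at this
    linarith
  have hYhist : ∀ i ∈ E, ∀ r ∈ Icc (S - hbar) S, Y r i = 1 := by
    intro i hi r hr
    rcases lt_or_eq_of_le hr.2 with h1 | h1
    · rw [hYh r h1 i]; simp [hp, hEq, hi]
    · rw [h1, hYS]; simp [hqq, hi]
  have hf : IntervalIntegrable (fun s => ∑ i ∈ E, ∑ j ∈ Eᶜ, b i j s) volume S T :=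
    ii_sum E fun i _ => ii_sum Eᶜ fun j _ => hc.bi i j S T
  have hf0 : ∀ s, 0 ≤ ∑ i ∈ E, ∑ j ∈ Eᶜ, b i j s := fun s =>
    Finset.sum_nonneg fun i _ => Finset.sum_nonneg fun j _ => hc.b0 i j s
  have hMP := hc.setMP E (x := Y) (ρ := fun t i => FF b h Y i t) (θ := 1) hST
    (fun i _ => hYP i T hST) hf (fun s _ => hf0 s)
    (fun j hj r hr => (hYhist j hj r hr).ge) (fun i hi r hr => by
      have e1 : FF b h Y i r = ∑ j ∈ E, b i j r * (Y (r - h i j r) j - Y r i) +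
        ∑ j ∈ Eᶜ, b i j r * (Y (r - h i j r) j - Y r i) := (Finset.sum_add_sum_compl E _).symm
      have e2 : -∑ j ∈ Eᶜ, b i j r ≤ ∑ j ∈ Eᶜ, b i j r * (Y (r - h i j r) j - Y r i) := by
        rw [← Finset.sum_neg_distrib]
        refine Finset.sum_le_sum fun j _ => ?_
        have := hYle r hr i
        have := hY0 (r - h i j r) j
        nlinarith [hc.b0 i j r]
      have e3 : ∑ j ∈ Eᶜ, b i j r ≤ ∑ i ∈ E, ∑ j ∈ Eᶜ, b i j r :=
        Finset.single_le_sum (f := fun i => ∑ j ∈ Eᶜ, b i j r)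
          (fun i _ => Finset.sum_nonneg fun j _ => hc.b0 i j r) hi
      linarith)
  have hmonoW : ∀ t ∈ Icc S T, ∫ s in S..t, (∑ i ∈ E, ∑ j ∈ Eᶜ, b i j s) ≤
      ∫ s in S..T, (∑ i ∈ E, ∑ j ∈ Eᶜ, b i j s) := fun t ht =>
    intervalIntegral.integral_mono_interval le_rfl ht.1 ht.2 (Eventually.of_forall hf0) hf
  refine ⟨fun i => ∫ s in S..T, ∑ j ∈ E, b i j s, ∫ s in S..T, (∑ i ∈ E, ∑ j ∈ Eᶜ, b i j s),
    intervalIntegral.integral_nonneg hST fun u _ => hf0 u,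
    fun i => intervalIntegral.integral_nonneg hST fun u _ =>
      Finset.sum_nonneg fun j _ => hc.b0 i j u, ?_, ?_, ?_, ?_⟩
  · intro i hi
    have := hMP i hi _ (hs' i)
    have := hmonoW _ (hs' i)
    linarith
  · intro i hi
    exact hMP i hi T ⟨hST, le_rfl⟩
  · intro i hi
    refine hc.Y_in hST E (hYP i T hST) hY0 (hB.hC i) (fun j hj t ht => ?_)
    by_cases h1 : t ≤ S
    · rw [hYhist j hj t ⟨ht.1, h1⟩]; exact hc1
    · exact hYE j hj t ⟨by linarith, ht.2⟩
  · rw [intervalIntegral.integral_finsetSum (fun i _ => ii_sum Eᶜ fun j _ => hc.bi i j S T)]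
    simp only [intervalIntegral.integral_finsetSum (fun j _ => hc.bi _ j S T)]
    rw [Finset.sum_comm, Finset.mul_sum]
    simp only [Finset.mul_sum]
    exact Finset.sum_le_sum fun i _ => Finset.sum_le_sum fun j _ => hB.sym j i

/-- One step of the dual Lyapunov estimate. -/
lemma step (hc : Core b h hbar) {S T C K : ℝ} (hB : Blk b hbar C K S T) (hC0 : 0 ≤ C)
    (hK : 1 ≤ K) {qm qe : V → ℝ}
    (hq : InQ (8 * K / Real.exp (-C) ^ 4) (Real.exp (-C) / 2) qm qe) {s : V → ℝ}
    (hs : ∀ i, s i ∈ Icc (T - hbar) T) {u g : ℝ → V → ℝ} {m e : V → ℝ}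
    (hu : ∀ i, Prim (fun t => u t i) (fun t => FF b h u i t + g t i) S T)
    (hg : ∀ i, IntervalIntegrable (fun t => g t i) volume S T)
    (hg0 : ∀ t ∈ Icc S T, ∀ i, 0 ≤ g t i)
    (hm : ∀ r ∈ Icc (S - hbar) S, ∀ i, m i ≤ u r i) (he : ∀ i, e i ≤ u S i) :
    ∃ qm' qe', InQ (8 * K / Real.exp (-C) ^ 4) (Real.exp (-C) / 2) qm' qe' ∧
      ∑ i, (qm' i * m i + qe' i * e i) +
        Real.exp (-C) ^ 2 * ∑ i, ∫ t in S..T, g t i ≤ ∑ i, (qm i * u (s i) i + qe i * u T i) := by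
  obtain ⟨ym, ye, hm0, he0, hY⟩ := hc.exists_basis S
  have hST : S ≤ T := by linarith [hB.len, hc.hbar0]
  have hs' : ∀ i, s i ∈ Icc S T := fun i => ⟨by linarith [(hs i).1, hB.len], (hs i).2⟩
  refine ⟨_, _, hc.transfer hB hC0 hK hq hs hm0 he0 hY, ?_⟩
  have hval := Yc_sum ym ye m e qm qe s T
  rw [← hval]
  obtain ⟨hYh, hYS, hYP⟩ := hY m e
  set Y := Yc ym ye m e with hYdef
  have hDP : ∀ i, Prim (fun t => u t i - Y t i)
      (fun t => FF b h (fun t i => u t i - Y t i) i t + g t i) S T := fun i => by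
    refine ((hu i).sub (hYP i T hST) hST).congr_ig (fun t _ => ?_) hST
    simp only [FF, mul_sub, Finset.sum_sub_distrib]; ring
  have hDh : ∀ r ∈ Icc (S - hbar) S, ∀ j, 0 ≤ u r j - Y r j := fun r hr j => by
    rcases lt_or_eq_of_le hr.2 with h1 | h1
    · rw [hYh r h1 j]; linarith [hm r hr j]
    · rw [h1, hYS]; linarith [he j]
  have hD0 : ∀ t ∈ Icc S T, ∀ i, 0 ≤ u t i - Y t i := by
    intro t ht i
    have := hc.setMP Finset.univ (x := fun t i => u t i - Y t i)
      (ρ := fun t i => FF b h (fun t i => u t i - Y t i) i t + g t i) (θ := 0) (f := fun _ => 0) hST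
      (fun i _ => hDP i) intervalIntegrable_const
      (fun _ _ => le_rfl) (fun j _ r hr => hDh r hr j) (fun i _ r hr => by
        have := hg0 r hr i
        simp only [FF, sub_zero]
        linarith) i (Finset.mem_univ i) t ht
    simpa using this
  have hDT : ∀ i, Real.exp (-C) * ∫ t in S..T, g t i ≤ u T i - Y T i := by
    intro i
    have := (hDP i).gronwall (γ := fun t => g t i) hST (hc.AA_int i S T) (hg i)
      (fun r _ => hc.AA_nonneg i r) (fun r hr => hg0 r hr i) (fun r hr => by
        have h1 : -(AA b i r * (u r i - Y r i)) ≤ FF b h (fun t i => u t i - Y t i) i r := by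
          have := hc.FF_ge (Y := fun t i => u t i - Y t i) (i := i) (s := r) ∅ (κ := 0)
            (fun r' hr' j => by
              by_cases h1 : r' ≤ S
              · exact hDh r' ⟨by linarith [hr'.1, hr.1], h1⟩ j
              · exact hD0 r' ⟨by linarith, hr'.2.trans hr.2⟩ j) (by simp)
          simpa using this
        linarith)
    refine le_trans ?_ this
    have h1 := hc.AA_int_mono hST le_rfl (hB.hC i)
    have h2 := hDh S ⟨by linarith [hc.hbar0], le_rfl⟩ i
    have h3 : 0 ≤ ∫ t in S..T, g t i := intervalIntegral.integral_nonneg hST fun r hr => hg0 r hr i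
    exact mul_le_mul h1 (by linarith) h3 (Real.exp_pos _).le
  have hqe : ∀ i, Real.exp (-C) ≤ qe i := by
    intro i
    have h1 := hq.2.2 ∅ {i} (by simp) (by simp)
    simp only [Finset.card_empty, pow_zero, Finset.card_singleton, pow_one, Finset.sum_empty,
      Finset.sum_singleton, zero_add] at h1
    have : 0 ≤ Real.exp (-C) / 2 * (8 * K / Real.exp (-C) ^ 4) := by positivity
    have hc1 : Real.exp (-C) ≤ 1 := Real.exp_le_one_iff.2 (by linarith)
    linarith
  rw [Finset.mul_sum, ← Finset.sum_add_distrib]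
  refine Finset.sum_le_sum fun i _ => ?_
  have h1 := mul_le_mul_of_nonneg_left (sub_nonneg.1 (hD0 _ (hs' i) i)) (hq.1 i)
  have h3 : 0 ≤ ∫ t in S..T, g t i := intervalIntegral.integral_nonneg hST fun r hr => hg0 r hr i
  have h2 : Real.exp (-C) * (Real.exp (-C) * ∫ t in S..T, g t i) ≤ qe i * (u T i - Y T i) :=
    mul_le_mul (hqe i) (hDT i) (by positivity) (hq.2.1 i)
  nlinarith

end Core

/-- A continuous bounded solution from time `T0`. -/
structure GSol (b h : V → V → ℝ → ℝ) (x : ℝ → V → ℝ) (T0 β : ℝ) : Prop where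
  cont : ∀ i, Continuous fun t => x t i
  bd : ∀ t i, |x t i| ≤ β
  eq : ∀ i, ∀ T ≥ T0, Prim (fun t => x t i) (FF b h x i) T0 T

/-- Energy dissipation density. -/
def EE (b h : V → V → ℝ → ℝ) (x : ℝ → V → ℝ) (s : ℝ) : ℝ :=
  ∑ i, ∑ j, b i j s * (x (s - h i j s) j - x s i) ^ 2

namespace Core
variable {b h : V → V → ℝ → ℝ} {hbar : ℝ}

lemma iter (hc : Core b h hbar) {C K B : ℝ} (hC0 : 0 ≤ C) (hK : 1 ≤ K) {τ : ℕ → ℝ}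
    (hτ : ∀ p, Blk b hbar C K (τ p) (τ (p+1))) {u g : ℝ → V → ℝ}
    (huc : ∀ i, Continuous fun t => u t i) (hu0 : ∀ t i, 0 ≤ u t i) (huB : ∀ t i, u t i ≤ B)
    (hu : ∀ p i, Prim (fun t => u t i) (fun t => FF b h u i t + g t i) (τ p) (τ (p+1)))
    (hg : ∀ p i, IntervalIntegrable (fun t => g t i) volume (τ p) (τ (p+1)))
    (hg0 : ∀ t i, 0 ≤ g t i) :
    ∃ R, ∀ N, ∑ p ∈ Finset.range N, ∑ i, ∫ t in (τ p)..(τ (p+1)), g t i ≤ R := by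
  have hmin : ∀ p i, ∃ s ∈ Icc (τ p - hbar) (τ p), ∀ r ∈ Icc (τ p - hbar) (τ p), u s i ≤ u r i :=
    fun p i => by
      obtain ⟨r, hr, h⟩ := isCompact_Icc.exists_isMinOn
        (⟨τ p, by linarith [hc.hbar0], le_rfl⟩ : (Icc (τ p - hbar) (τ p)).Nonempty)
        (huc i).continuousOn
      exact ⟨r, hr, fun r' hr' => h hr'⟩
  choose s hs hsm using hmin
  set Γ := 8 * K / Real.exp (-C) ^ 4 with hΓ
  set ρ := Real.exp (-C) / 2 with hρ
  have hrec : ∀ N, ∀ qm qe : V → ℝ, InQ Γ ρ qm qe → ∃ qm' qe', InQ Γ ρ qm' qe' ∧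
      ∑ i, (qm' i * u (s 0 i) i + qe' i * u (τ 0) i) + Real.exp (-C) ^ 2 *
        ∑ p ∈ Finset.range N, ∑ i, ∫ t in (τ p)..(τ (p+1)), g t i ≤
      ∑ i, (qm i * u (s N i) i + qe i * u (τ N) i) := by
    intro N
    induction N with
    | zero => intro qm qe hq; exact ⟨qm, qe, hq, by simp⟩
    | succ N ih =>
      intro qm qe hq
      obtain ⟨qm1, qe1, hq1, h1⟩ := hc.step (hτ N) hC0 hK hq (s := s (N+1)) (hs (N+1)) (hu N) (hg N)
        (fun t _ i => hg0 t i) (m := fun i => u (s N i) i) (e := fun i => u (τ N) i)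
        (fun r hr i => hsm N i r hr) (fun i => le_rfl)
      obtain ⟨qm2, qe2, hq2, h2⟩ := ih qm1 qe1 hq1
      refine ⟨qm2, qe2, hq2, ?_⟩
      rw [Finset.sum_range_succ, mul_add]
      linarith
  have hc1 : Real.exp (-C) ≤ 1 := Real.exp_le_one_iff.2 (by linarith)
  have hc0 := Real.exp_pos (-C)
  have hΓ1 : 1 ≤ Γ := by
    rw [hΓ, le_div_iff₀ (by positivity)]
    have : Real.exp (-C) ^ 4 ≤ 1 := pow_le_one₀ hc0.le hc1
    linarith
  set n := Fintype.card V
  have hQ : InQ Γ ρ (fun _ : V => 2 * Γ ^ n) (fun _ : V => 2 * Γ ^ n) := by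
    have hp : 0 < Γ ^ n := by positivity
    refine ⟨fun _ => by positivity, fun _ => by positivity, fun M E hME hE => ?_⟩
    simp only [Finset.sum_const, nsmul_eq_mul]
    have h1 : Γ ^ M.card ≤ Γ ^ n := pow_le_pow_right₀ hΓ1 (Finset.card_le_univ M)
    have h2 : Γ ^ E.card ≤ Γ ^ n := pow_le_pow_right₀ hΓ1 (Finset.card_le_univ E)
    have h3 : (1:ℝ) ≤ E.card := by exact_mod_cast hE.card_pos
    have h4 : (0:ℝ) ≤ M.card * (2 * Γ ^ n) := by positivity
    have h5 : ρ * Γ ^ E.card ≤ 1 * Γ ^ n :=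
      mul_le_mul (by linarith) h2 (by positivity) (by norm_num)
    nlinarith
  refine ⟨(∑ i : V, (2 * Γ ^ n * B + 2 * Γ ^ n * B)) / Real.exp (-C) ^ 2, fun N => ?_⟩
  obtain ⟨qm', qe', hq', h1⟩ := hrec N _ _ hQ
  rw [le_div_iff₀ (by positivity)]
  have h2 : 0 ≤ ∑ i, (qm' i * u (s 0 i) i + qe' i * u (τ 0) i) := Finset.sum_nonneg fun i _ =>
    add_nonneg (mul_nonneg (hq'.1 i) (hu0 _ _)) (mul_nonneg (hq'.2.1 i) (hu0 _ _))
  have h3 : ∑ i, (2 * Γ ^ n * u (s N i) i + 2 * Γ ^ n * u (τ N) i) ≤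
      ∑ i : V, (2 * Γ ^ n * B + 2 * Γ ^ n * B) := Finset.sum_le_sum fun i _ => by
    have := huB (s N i) i
    have := huB (τ N) i
    gcongr
  linarith

variable {x : ℝ → V → ℝ} {T0 β : ℝ}

lemma d_meas (hc : Core b h hbar) (hx : GSol b h x T0 β) (i j : V) :
    Measurable fun s => x (s - h i j s) j - x s i :=
  ((hx.cont j).measurable.comp (measurable_id.sub (hc.hm i j))).sub (hx.cont i).measurable

lemma d_bd (hx : GSol b h x T0 β) (i j : V) (s : ℝ) : |x (s - h i j s) j - x s i| ≤ 2 * β := by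
  have h1 := abs_le.1 (hx.bd (s - h i j s) j)
  have h2 := abs_le.1 (hx.bd s i)
  exact abs_le.2 ⟨by linarith, by linarith⟩

lemma d2_int (hc : Core b h hbar) (hx : GSol b h x T0 β) (i j : V) (s t : ℝ) :
    IntervalIntegrable (fun s => b i j s * (x (s - h i j s) j - x s i) ^ 2) volume s t :=
  hc.int_mul i j ((hc.d_meas hx i j).pow_const 2) (B := (2 * β) ^ 2) (fun s => by
    rw [abs_pow]; exact pow_le_pow_left₀ (abs_nonneg _) (d_bd hx i j s) 2) s t

lemma EE_nonneg (hc : Core b h hbar) (s : ℝ) : 0 ≤ EE b h x s :=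
  Finset.sum_nonneg fun i _ => Finset.sum_nonneg fun j _ => mul_nonneg (hc.b0 i j s) (sq_nonneg _)

lemma EE_int (hc : Core b h hbar) (hx : GSol b h x T0 β) (s t : ℝ) :
    IntervalIntegrable (EE b h x) volume s t :=
  ii_sum _ fun i _ => ii_sum _ fun j _ => hc.d2_int hx i j s t

/-- Boundedness of the total energy dissipation. -/
lemma energy (hc : Core b h hbar) (hx : GSol b h x T0 β) {C K : ℝ} (hC0 : 0 ≤ C) (hK : 1 ≤ K)
    {τ : ℕ → ℝ} (hτ : ∀ p, Blk b hbar C K (τ p) (τ (p+1))) (hT0 : T0 ≤ τ 0)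
    (hlim : Tendsto τ atTop atTop) :
    ∃ R, ∀ t, ∫ s in (τ 0)..t, EE b h x s ≤ R := by
  have hmono : Monotone τ := monotone_nat_of_le_succ fun p => by linarith [(hτ p).len, hc.hbar0]
  have hgi : ∀ i s t, IntervalIntegrable
      (fun s => ∑ j, b i j s * (x (s - h i j s) j - x s i) ^ 2) volume s t :=
    fun i s t => ii_sum _ fun j _ => hc.d2_int hx i j s t
  obtain ⟨R, hR⟩ := hc.iter (B := β ^ 2) hC0 hK hτ (u := fun t i => β ^ 2 + -(x t i * x t i))
    (g := fun s i => ∑ j, b i j s * (x (s - h i j s) j - x s i) ^ 2)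
    (fun i => continuous_const.add ((hx.cont i).mul (hx.cont i)).neg)
    (fun t i => by
      have := abs_le.1 (hx.bd t i)
      nlinarith) (fun t i => by nlinarith [mul_self_nonneg (x t i)])
    (fun p i => by
      have h1 : τ p ≤ τ (p+1) := hmono (Nat.le_succ p)
      have h2 : T0 ≤ τ p := hT0.trans (hmono (Nat.zero_le p))
      have hP := (hx.eq i (τ (p+1)) (h2.trans h1)).mono h2 h1 le_rfl
      refine (((Prim.const (β ^ 2)).add (hP.mul hP h1).neg h1)).congr_ig (fun t _ => ?_) h1
      simp only [FF, Finset.mul_sum, Finset.sum_mul, ← Finset.sum_add_distrib,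
        ← Finset.sum_neg_distrib, zero_add]
      refine Finset.sum_congr rfl fun j _ => ?_
      ring) (fun p i => hgi i _ _)
    (fun t i => Finset.sum_nonneg fun j _ => mul_nonneg (hc.b0 i j t) (sq_nonneg _))
  refine ⟨R, fun t => ?_⟩
  obtain ⟨N, hN⟩ := ((tendsto_atTop.1 hlim) (max t (τ 0))).exists
  have h1 : ∫ s in (τ 0)..(τ N), EE b h x s ≤ R := by
    rw [← intervalIntegral.sum_integral_adjacent_intervals (fun k _ => hc.EE_int hx _ _)]
    refine le_trans (le_of_eq ?_) (hR N)
    refine Finset.sum_congr rfl fun p _ => ?_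
    simp only [EE]
    rw [intervalIntegral.integral_finsetSum (fun i _ => hgi i _ _)]
  by_cases ht : t ≤ τ 0
  · have h2 : ∫ s in (τ 0)..t, EE b h x s ≤ 0 := by
      rw [intervalIntegral.integral_symm]
      have := intervalIntegral.integral_nonneg (μ := volume) ht fun u _ => hc.EE_nonneg (x := x) u
      linarith
    have h3 : 0 ≤ ∫ s in (τ 0)..(τ N), EE b h x s :=
      intervalIntegral.integral_nonneg (hmono (Nat.zero_le N)) fun u _ => hc.EE_nonneg (x := x) u
    linarith
  · refine le_trans (intervalIntegral.integral_mono_interval le_rfl (not_le.1 ht).le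
      ((le_max_left _ _).trans hN) (Eventually.of_forall fun s => hc.EE_nonneg (x := x) s)
      (hc.EE_int hx _ _)) h1

end Core

namespace Core
variable {b h : V → V → ℝ → ℝ} {hbar : ℝ} {x : ℝ → V → ℝ} {T0 β : ℝ}

/-- Small tails of the energy. -/
lemma energy_tail (hc : Core b h hbar) (hx : GSol b h x T0 β) {T1 R : ℝ}
    (hR : ∀ t, ∫ s in T1..t, EE b h x s ≤ R) {ε : ℝ} (hε : 0 < ε) :
    ∃ T ≥ T1, ∀ s ≥ T, ∀ t, ∫ r in s..t, EE b h x r ≤ ε := by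
  set F : ℝ → ℝ := fun t => ∫ s in T1..t, EE b h x s with hF
  have hbdd : BddAbove (F '' Ici T1) := ⟨R, by rintro _ ⟨t, _, rfl⟩; exact hR t⟩
  have hne : (F '' Ici T1).Nonempty := ⟨_, T1, mem_Ici.2 le_rfl, rfl⟩
  obtain ⟨_, ⟨T, hT, rfl⟩, hTs⟩ := exists_lt_of_lt_csSup hne (sub_lt_self (sSup (F '' Ici T1)) hε)
  have hadd : ∀ s t, F s + ∫ r in s..t, EE b h x r = F t := fun s t =>
    intervalIntegral.integral_add_adjacent_intervals (hc.EE_int hx _ _) (hc.EE_int hx _ _)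
  refine ⟨T, hT, fun s hs t => ?_⟩
  have h1 : 0 ≤ ∫ r in T..s, EE b h x r :=
    intervalIntegral.integral_nonneg hs fun u _ => hc.EE_nonneg (x := x) u
  by_cases hst : s ≤ t
  · have h2 : F t ≤ sSup (F '' Ici T1) :=
      le_csSup hbdd ⟨t, (mem_Ici.1 hT).trans (hs.le.trans hst), rfl⟩
    have := hadd s t
    have := hadd T s
    linarith
  · rw [intervalIntegral.integral_symm]
    have := intervalIntegral.integral_nonneg (μ := volume) (not_le.1 hst).le
      fun u _ => hc.EE_nonneg (x := x) u
    linarith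

/-- Slow variation. -/
lemma slow (hc : Core b h hbar) (hx : GSol b h x T0 β) {T1 R M : ℝ} (hT1 : T0 ≤ T1)
    (hR : ∀ t, ∫ s in T1..t, EE b h x s ≤ R) (hM0 : 0 ≤ M)
    (hM : ∀ t ≥ T1, ∀ i, ∫ s in t..(t + hbar), AA b i s ≤ M) {ε : ℝ} (hε : 0 < ε) :
    ∃ T ≥ T1, ∀ s ≥ T, ∀ t ∈ Icc s (s + hbar), ∀ i, |x t i - x s i| ≤ ε := by
  set γ := ε / (2 * (M + 1)) with hγ
  have hγ0 : 0 < γ := by positivity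
  obtain ⟨T, hT, hTail⟩ := hc.energy_tail hx hR (ε := γ * (ε / 2)) (by positivity)
  refine ⟨T, hT, fun s hs t ht i => ?_⟩
  have hsT0 : T0 ≤ s := hT1.trans (hT.le.trans hs)
  have h1 := (hx.eq i t (hsT0.trans ht.1)).sub_eq hsT0 ht.1 le_rfl
  have hFi := (hx.eq i t (hsT0.trans ht.1)).intervalIntegrable hsT0 ht.1 le_rfl
  have h2 : x t i - x s i = ∫ r in s..t, FF b h x i r := by linarith
  rw [h2]
  have h3 : |∫ r in s..t, FF b h x i r| ≤ ∫ r in s..t, |FF b h x i r| :=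
    intervalIntegral.abs_integral_le_integral_abs ht.1
  have h4 : ∫ r in s..t, |FF b h x i r| ≤ ∫ r in s..t, (γ * AA b i r + (1 / γ) * EE b h x r) := by
    refine intervalIntegral.integral_mono_on ht.1 hFi.abs
      (((hc.AA_int i s t).const_mul _).add ((hc.EE_int hx s t).const_mul _)) fun r hr => ?_
    have e1 : |FF b h x i r| ≤ ∑ j, b i j r * |x (r - h i j r) j - x r i| := by
      refine (Finset.abs_sum_le_sum_abs _ _).trans (le_of_eq ?_)
      refine Finset.sum_congr rfl fun j _ => ?_
      rw [abs_mul, abs_of_nonneg (hc.b0 i j r)]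
    have e2 : ∑ j, b i j r * |x (r - h i j r) j - x r i| ≤
        ∑ j, (γ * b i j r + (1 / γ) * (b i j r * (x (r - h i j r) j - x r i) ^ 2)) := by
      refine Finset.sum_le_sum fun j _ => ?_
      set d := x (r - h i j r) j - x r i
      have e3 : |d| ≤ γ + (1 / γ) * d ^ 2 := by
        have : |d| * γ ≤ γ ^ 2 + d ^ 2 := by
          rw [← sq_abs d]; nlinarith [sq_nonneg (|d| - γ), abs_nonneg d]
        have e4 : γ + (1 / γ) * d ^ 2 = (γ ^ 2 + d ^ 2) / γ := by field_simp
        rw [e4, le_div_iff₀ hγ0]; exact this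
      have := mul_le_mul_of_nonneg_left e3 (hc.b0 i j r)
      linarith
    rw [Finset.sum_add_distrib, ← Finset.mul_sum, ← Finset.mul_sum] at e2
    have e5 : ∑ j, b i j r * (x (r - h i j r) j - x r i) ^ 2 ≤ EE b h x r :=
      Finset.single_le_sum (f := fun i => ∑ j, b i j r * (x (r - h i j r) j - x r i) ^ 2)
        (fun i _ => Finset.sum_nonneg fun j _ => mul_nonneg (hc.b0 i j r) (sq_nonneg _))
        (Finset.mem_univ i)
    have e6 := mul_le_mul_of_nonneg_left e5 (by positivity : 0 ≤ 1 / γ)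
    simp only [AA]
    linarith
  rw [intervalIntegral.integral_add ((hc.AA_int i s t).const_mul _)
    ((hc.EE_int hx s t).const_mul _), intervalIntegral.integral_const_mul,
    intervalIntegral.integral_const_mul] at h4
  have h5 : ∫ r in s..t, AA b i r ≤ M := by
    refine le_trans ?_ (hM s (hT.le.trans hs) i)
    exact intervalIntegral.integral_mono_interval le_rfl ht.1 ht.2
      (Eventually.of_forall fun r => hc.AA_nonneg i r) (hc.AA_int i _ _)
  have h6 := hTail s hs t
  have h7 : γ * (∫ r in s..t, AA b i r) ≤ ε / 2 := by
    calc γ * (∫ r in s..t, AA b i r) ≤ γ * (M + 1) := by gcongr; linarith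
      _ = ε / 2 := by rw [hγ]; field_simp
  have h8 : (1 / γ) * (∫ r in s..t, EE b h x r) ≤ ε / 2 := by
    calc (1 / γ) * (∫ r in s..t, EE b h x r) ≤ (1 / γ) * (γ * (ε / 2)) := by gcongr
      _ = ε / 2 := by field_simp
  linarith

/-- One-sided barrier. -/
lemma half (hc : Core b h hbar) (hx : GSol b h x T0 β) {T t1 θ w : ℝ} (hT0 : T0 ≤ T)
    (hT : T ≤ t1) (hw : 0 < w) (U : Finset V)
    (h0 : ∀ j ∈ U, ∀ r ∈ Icc (T - hbar) T, θ ≤ x r j)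
    (hsep : ∀ i ∈ U, ∀ j ∉ U, ∀ s ∈ Icc T t1, x (s - h i j s) j - x s i ≤ -w) :
    ∀ i ∈ U, θ - (1 / w) * (∫ s in T..t1, EE b h x s) ≤ x t1 i := by
  intro i hi
  have := hc.setMP U (x := x) (ρ := fun t i => FF b h x i t) (θ := θ)
    (f := fun s => (1 / w) * EE b h x s) hT
    (fun i _ => (hx.eq i t1 (hT0.trans hT)).mono hT0 hT le_rfl)
    ((hc.EE_int hx T t1).const_mul _)
    (fun s _ => mul_nonneg (by positivity) (hc.EE_nonneg (x := x) s)) h0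
    (fun i hi r hr => by
      have e1 : FF b h x i r = ∑ j ∈ U, b i j r * (x (r - h i j r) j - x r i) +
        ∑ j ∈ Uᶜ, b i j r * (x (r - h i j r) j - x r i) := (Finset.sum_add_sum_compl U _).symm
      have e2 : -((1 / w) * ∑ j ∈ Uᶜ, b i j r * (x (r - h i j r) j - x r i) ^ 2) ≤
          ∑ j ∈ Uᶜ, b i j r * (x (r - h i j r) j - x r i) := by
        rw [Finset.mul_sum, ← Finset.sum_neg_distrib]
        refine Finset.sum_le_sum fun j hj => ?_
        have hd := hsep i hi j (by simpa using hj) r hr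
        set d := x (r - h i j r) j - x r i
        have e3 : -((1 / w) * d ^ 2) ≤ d := by
          have : -d ≤ d ^ 2 / w := by rw [le_div_iff₀ hw]; nlinarith
          have e4 : (1 / w) * d ^ 2 = d ^ 2 / w := by ring
          linarith
        have := mul_le_mul_of_nonneg_left e3 (hc.b0 i j r)
        linarith
      have e5 : ∑ j ∈ Uᶜ, b i j r * (x (r - h i j r) j - x r i) ^ 2 ≤ EE b h x r :=
        le_trans (Finset.sum_le_sum_of_subset_of_nonneg (Finset.subset_univ _) fun j _ _ =>
            mul_nonneg (hc.b0 i j r) (sq_nonneg _))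
          (Finset.single_le_sum (f := fun i => ∑ j, b i j r * (x (r - h i j r) j - x r i) ^ 2)
          (fun i _ => Finset.sum_nonneg fun j _ => mul_nonneg (hc.b0 i j r) (sq_nonneg _))
          (Finset.mem_univ i))
      have e6 := mul_le_mul_of_nonneg_left e5 (by positivity : 0 ≤ 1 / w)
      linarith) i hi t1 ⟨hT, le_rfl⟩
  rwa [intervalIntegral.integral_const_mul] at this

lemma neg_sol (hx : GSol b h x T0 β) : GSol b h (fun t i => -x t i) T0 β :=
  ⟨fun i => (hx.cont i).neg, fun t i => by rw [abs_neg]; exact hx.bd t i, fun i T hT =>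
    ((hx.eq i T hT).neg).congr_ig (fun t _ => by
      simp only [FF, ← Finset.sum_neg_distrib]
      exact Finset.sum_congr rfl fun j _ => by ring) hT⟩

lemma neg_EE : EE b h (fun t i => -x t i) = EE b h x := by
  ext s
  simp only [EE]
  exact Finset.sum_congr rfl fun i _ => Finset.sum_congr rfl fun j _ => by ring

/-- Two-sided barrier. -/
lemma barrier (hc : Core b h hbar) (hx : GSol b h x T0 β) {T L w : ℝ} (hT0 : T0 ≤ T)
    (hw : 0 < w) (U : Finset V) (hE : ∀ t, ∫ r in T..t, EE b h x r ≤ w ^ 2 / 4)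
    (h0 : ∀ j ∈ U, ∀ r ∈ Icc (T - hbar) T, L + w ≤ x r j)
    (h1 : ∀ j ∉ U, ∀ r ∈ Icc (T - hbar) T, x r j ≤ L - w) :
    ∀ t ≥ T, (∀ j ∈ U, L + w / 2 < x t j) ∧ (∀ j ∉ U, x t j < L - w / 2) := by
  by_contra hcon
  push Not at hcon
  obtain ⟨t2, ht2, hbad⟩ := hcon
  set Bad : Set ℝ := {t | (∃ j ∈ U, x t j ≤ L + w / 2) ∨ (∃ j ∉ U, L - w / 2 ≤ x t j)} with hBad
  have hBc : IsClosed Bad := by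
    have e : Bad = (⋃ j ∈ U, {t | x t j ≤ L + w / 2}) ∪ (⋃ j ∈ Uᶜ, {t | L - w / 2 ≤ x t j}) := by
      ext t; simp [hBad]
    rw [e]
    refine IsClosed.union (isClosed_biUnion_finset fun j _ => ?_)
      (isClosed_biUnion_finset fun j _ => ?_)
    · exact isClosed_le (hx.cont j) continuous_const
    · exact isClosed_le continuous_const (hx.cont j)
  have hcomp : IsCompact (Bad ∩ Icc T t2) := isCompact_Icc.inter_left hBc
  have hne : (Bad ∩ Icc T t2).Nonempty := by
    refine ⟨t2, ?_, ht2, le_rfl⟩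
    by_cases hh : ∀ j ∈ U, L + w / 2 < x t2 j
    · exact Or.inr (hbad hh)
    · push Not at hh; exact Or.inl hh
  obtain ⟨t, ⟨htB, htI⟩, hleast⟩ := hcomp.exists_isLeast hne
  have hgood : ∀ r ∈ Ico T t, (∀ j ∈ U, L + w / 2 < x r j) ∧ (∀ j ∉ U, x r j < L - w / 2) := by
    intro r hr
    by_contra hc2
    have : r ∈ Bad := by
      by_cases hh : ∀ j ∈ U, L + w / 2 < x r j
      · right; by_contra h3; push Not at h3; exact hc2 ⟨hh, h3⟩
      · push Not at hh; exact Or.inl hh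
    have := hleast ⟨this, hr.1, hr.2.le.trans htI.2⟩
    exact absurd hr.2 (not_lt.2 this)
  have hTt : T < t := by
    rcases lt_or_eq_of_le htI.1 with h2 | h2
    · exact h2
    · exfalso
      rw [← h2] at htB
      have hmem : T ∈ Icc (T - hbar) T := ⟨by linarith [hc.hbar0], le_rfl⟩
      rcases htB with ⟨j, hj, hjx⟩ | ⟨j, hj, hjx⟩
      · linarith [h0 j hj T hmem]
      · linarith [h1 j hj T hmem]
  have hall : ∀ r ∈ Ico (T - hbar) t, (∀ j ∈ U, L + w / 2 ≤ x r j) ∧ (∀ j ∉ U, x r j ≤ L - w / 2) := by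
    intro r hr
    by_cases hrT : r ≤ T
    · exact ⟨fun j hj => by linarith [h0 j hj r ⟨hr.1, hrT⟩],
        fun j hj => by linarith [h1 j hj r ⟨hr.1, hrT⟩]⟩
    · have := hgood r ⟨by linarith, hr.2⟩
      exact ⟨fun j hj => (this.1 j hj).le, fun j hj => (this.2 j hj).le⟩
  have hmemd : ∀ i j s, s ∈ Ico T t → s - h i j s ∈ Ico (T - hbar) t := fun i j s hs =>
    ⟨by linarith [hc.h1 i j s, hs.1], by linarith [hc.h0 i j s, hs.2]⟩
  have hEw : ∀ t, (1 / w) * (∫ s in T..t, EE b h x s) ≤ w / 4 := fun t => by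
    calc (1 / w) * (∫ s in T..t, EE b h x s) ≤ (1 / w) * (w ^ 2 / 4) := by gcongr; exact hE t
      _ = w / 4 := by field_simp
  have hU : ∀ r ∈ Ico T t, ∀ j ∈ U, L + 3 * w / 4 ≤ x r j := by
    intro r hr j hj
    have := hc.half hx (θ := L + w) hT0 hr.1 hw U h0 (fun i hi j hj s hs => by
      have hs' : s ∈ Ico T t := ⟨hs.1, hs.2.trans_lt hr.2⟩
      have e1 := (hall _ (hmemd i j s hs')).2 j hj
      have e2 := (hgood s hs').1 i hi
      linarith) j hj
    linarith [hEw r]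
  have hUc : ∀ r ∈ Ico T t, ∀ j ∉ U, x r j ≤ L - 3 * w / 4 := by
    intro r hr j hj
    have := hc.half (neg_sol hx) (θ := -L + w) hT0 hr.1 hw Uᶜ (fun j hj r hr => by
        have := h1 j (by simpa using hj) r hr
        linarith) (fun i hi j hj s hs => by
      have hs' : s ∈ Ico T t := ⟨hs.1, hs.2.trans_lt hr.2⟩
      have e1 := (hall _ (hmemd i j s hs')).1 j (by simpa using hj)
      have e2 := (hgood s hs').2 i (by simpa using hi)
      linarith) j (by simpa using hj)
    rw [neg_EE] at this
    linarith [hEw r]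
  have hev : ∀ᶠ r in 𝓝[<] t, r ∈ Ico T t := Ico_mem_nhdsLT hTt
  have htend : ∀ j, Tendsto (fun r => x r j) (𝓝[<] t) (𝓝 (x t j)) := fun j =>
    ((hx.cont j).tendsto t).mono_left nhdsWithin_le_nhds
  rcases htB with ⟨j, hj, hjx⟩ | ⟨j, hj, hjx⟩
  · have := ge_of_tendsto (htend j) (hev.mono fun r hr => hU r hr j hj)
    linarith
  · have := le_of_tendsto (htend j) (hev.mono fun r hr => hUc r hr j hj)
    linarith

/-- Pigeonhole: a gap free of values. -/
lemma exists_gap (v : V → ℝ) (α g : ℝ) :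
    ∃ k : Fin (Fintype.card V + 1), ∀ j, v j ≤ α + (k:ℕ) * g ∨ α + ((k:ℕ) + 1) * g ≤ v j := by
  by_contra hcon
  push Not at hcon
  choose f hf using hcon
  have hinj : Function.Injective f := by
    intro k l hkl
    have h1 := hf k
    have h2 := hf l
    rw [← hkl] at h2
    by_contra hne
    have hg : 0 < g := by nlinarith [h1.1, h1.2]
    rcases lt_or_gt_of_ne (fun e => hne (Fin.ext e) : (k:ℕ) ≠ l) with h3 | h3
    · have : ((k:ℕ):ℝ) + 1 ≤ (l:ℕ) := by exact_mod_cast h3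
      nlinarith [h1.2, h2.1]
    · have : ((l:ℕ):ℝ) + 1 ≤ (k:ℕ) := by exact_mod_cast h3
      nlinarith [h1.1, h2.2]
  have := Fintype.card_le_of_injective f hinj
  simp at this

/-- Convergence of bounded solutions. -/
lemma converge (hc : Core b h hbar) (hx : GSol b h x T0 β) {T1 R M : ℝ} (hT1 : T0 ≤ T1)
    (hR : ∀ t, ∫ s in T1..t, EE b h x s ≤ R) (hM0 : 0 ≤ M)
    (hM : ∀ t ≥ T1, ∀ i, ∫ s in t..(t + hbar), AA b i s ≤ M) (i : V) :
    ∃ c, Tendsto (fun t => x t i) atTop (𝓝 c) := by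
  refine tendsto_of_no_upcrossings dense_univ ?_ ?_ ?_
  · rintro α - β' - hαβ ⟨hlo, hhi⟩
    set g := (β' - α) / (Fintype.card V + 1 : ℝ) with hg
    have hn : (0:ℝ) < (Fintype.card V + 1 : ℝ) := by positivity
    have hg0 : 0 < g := div_pos (by linarith) hn
    obtain ⟨Ta, hTa, hslow⟩ := hc.slow hx hT1 hR hM0 hM (ε := g / 8) (by positivity)
    obtain ⟨Tb, hTb, htail⟩ := hc.energy_tail hx hR (ε := (g / 4) ^ 2 / 4) (by positivity)
    set T := max Ta Tb + hbar with hT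
    have hTaT : Ta ≤ T - hbar := by rw [hT]; linarith [le_max_left Ta Tb]
    have hTbT : Tb ≤ T := by rw [hT]; linarith [le_max_right Ta Tb, hc.hbar0]
    obtain ⟨k, hk⟩ := exists_gap (fun j => x T j) α g
    set L := α + ((k:ℕ) + 1 / 2) * g with hL
    have hLα : α ≤ L := by rw [hL]; have : 0 ≤ ((k:ℕ) + 1 / 2) * g := by positivity
                           linarith
    have hLβ : L ≤ β' := by
      have h1 : ((k:ℕ):ℝ) + 1 ≤ (Fintype.card V + 1 : ℝ) := by exact_mod_cast k.2
      have h2 : β' = α + (Fintype.card V + 1 : ℝ) * g := by rw [hg]; field_simp; ring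
      rw [hL, h2]; nlinarith
    have hvar : ∀ j, ∀ r ∈ Icc (T - hbar) T, |x r j - x T j| ≤ g / 4 := by
      intro j r hr
      have h1 := abs_le.1 (hslow (T - hbar) hTaT r ⟨hr.1, by linarith [hr.2]⟩ j)
      have h2 := abs_le.1 (hslow (T - hbar) hTaT T ⟨by linarith [hc.hbar0], by linarith⟩ j)
      exact abs_le.2 ⟨by linarith, by linarith⟩
    have hbar' := hc.barrier hx (T := T) (L := L) (w := g / 4)
      (by linarith [hc.hbar0]) (by positivity)
      (Finset.univ.filter fun j => α + ((k:ℕ) + 1) * g ≤ x T j)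
      (fun t => htail T hTbT t)
      (fun j hj r hr => by
        have h1 := abs_le.1 (hvar j r hr)
        simp only [Finset.mem_filter, Finset.mem_univ, true_and] at hj
        rw [hL]; linarith)
      (fun j hj r hr => by
        have h1 := abs_le.1 (hvar j r hr)
        simp only [Finset.mem_filter, Finset.mem_univ, true_and] at hj
        have h2 := (hk j).resolve_right hj
        rw [hL]; linarith)
    by_cases hi : i ∈ Finset.univ.filter fun j => α + ((k:ℕ) + 1) * g ≤ x T j
    · obtain ⟨t, ht, ht2⟩ := (hlo.and_eventually (eventually_ge_atTop T)).exists
      have := (hbar' t ht2).1 i hi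
      linarith
    · obtain ⟨t, ht, ht2⟩ := (hhi.and_eventually (eventually_ge_atTop T)).exists
      have := (hbar' t ht2).2 i hi
      linarith
  · exact isBoundedUnder_of ⟨β, fun t => (abs_le.1 (hx.bd t i)).2⟩
  · exact isBoundedUnder_of ⟨-β, fun t => (abs_le.1 (hx.bd t i)).1⟩

/-- Distinct limits force a finite total weight. -/
lemma finite_weight (hc : Core b h hbar) (hx : GSol b h x T0 β) {T1 R : ℝ}
    (hR : ∀ t, ∫ s in T1..t, EE b h x s ≤ R) {i j : V} {ci cj : ℝ}
    (hi : Tendsto (fun t => x t i) atTop (𝓝 ci)) (hj : Tendsto (fun t => x t j) atTop (𝓝 cj))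
    (hne : ci ≠ cj) : ∃ T B : ℝ, ∀ t ≥ T, ∫ s in T..t, b i j s ≤ B := by
  have hdel : Tendsto (fun s => s - h i j s) atTop atTop :=
    tendsto_atTop_mono (fun s => by linarith [hc.h1 i j s] : ∀ s, s - hbar ≤ s - h i j s)
      (tendsto_atTop_add_const_right _ _ tendsto_id)
  have hd : Tendsto (fun s => (x (s - h i j s) j - x s i) ^ 2) atTop (𝓝 ((cj - ci) ^ 2)) :=
    ((hj.comp hdel).sub hi).pow 2
  have hpos : 0 < (cj - ci) ^ 2 := by
    have : cj - ci ≠ 0 := sub_ne_zero.2 hne.symm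
    positivity
  have hev := hd.eventually (lt_mem_nhds (half_lt_self hpos))
  obtain ⟨T2, hT2⟩ := eventually_atTop.1 hev
  obtain ⟨T3, hT3, htail⟩ := hc.energy_tail hx hR (ε := 1) one_pos
  refine ⟨max T2 T3, 1 / ((cj - ci) ^ 2 / 2), fun t ht => ?_⟩
  rw [le_div_iff₀ (by positivity), ← intervalIntegral.integral_mul_const]
  refine le_trans (intervalIntegral.integral_mono_on ht ((hc.bi i j _ _).mul_const _)
    (hc.EE_int hx _ _) fun s hs => ?_) (htail _ (le_max_right _ _) t)
  have h1 := (hT2 s ((le_max_left _ _).trans hs.1)).le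
  have h2 := mul_le_mul_of_nonneg_left h1 (hc.b0 i j s)
  refine h2.trans ?_
  refine le_trans (Finset.single_le_sum (f := fun j => b i j s * (x (s - h i j s) j - x s i) ^ 2)
    (fun j _ => mul_nonneg (hc.b0 i j s) (sq_nonneg _)) (Finset.mem_univ j)) ?_
  exact Finset.single_le_sum (f := fun i => ∑ j, b i j s * (x (s - h i j s) j - x s i) ^ 2)
    (fun i _ => Finset.sum_nonneg fun j _ => mul_nonneg (hc.b0 i j s) (sq_nonneg _))
    (Finset.mem_univ i)

end Core

/-- Normalised weights. -/
noncomputable def nb (a : V → V → ℝ → ℝ) (i j : V) (s : ℝ) : ℝ :=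
  if i = j ∨ s < 0 then 0 else a i j s

/-- Normalised delays. -/
noncomputable def nh (h : V → V → ℝ → ℝ) (i j : V) (s : ℝ) : ℝ :=
  if s < 0 then 0 else h i j s

lemma nb_eq {a : V → V → ℝ → ℝ} {i j : V} (hij : i ≠ j) {s : ℝ} (hs : 0 ≤ s) :
    nb a i j s = a i j s := by
  simp [nb, hij, not_lt.2 hs]

lemma nb_self (a : V → V → ℝ → ℝ) (i : V) (s : ℝ) : nb a i i s = 0 := by
  simp [nb]

lemma nh_eq {h : V → V → ℝ → ℝ} {i j : V} {s : ℝ} (hs : 0 ≤ s) : nh h i j s = h i j s := by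
  simp [nh, not_lt.2 hs]

lemma core_of {a h : V → V → ℝ → ℝ} {hbar : ℝ} (hW : Weights a) (hbar0 : 0 ≤ hbar)
    (hD : Delays h hbar) : Core (nb a) (nh h) hbar := by
  refine ⟨hbar0, fun i j => ?_, fun i j s => ?_, fun i j s t => ?_, fun i j => ?_, fun i j s => ?_,
    fun i j s => ?_⟩
  · by_cases hij : i = j
    · subst hij
      have : nb a i i = fun _ => 0 := by ext s; exact nb_self a i s
      rw [this]; exact measurable_const
    · have : nb a i j = fun s => if s < 0 then 0 else a i j s := by ext s; simp [nb, hij]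
      rw [this]
      exact Measurable.ite measurableSet_Iio measurable_const (hW i j hij).1
  · unfold nb; split_ifs with h1
    · exact le_rfl
    · push Not at h1; exact (hW i j h1.1).2.1 s h1.2
  · by_cases hij : i = j
    · subst hij
      have : nb a i i = fun _ => 0 := by ext s; exact nb_self a i s
      rw [this]; exact intervalIntegrable_const
    · have h1 : Integrable (indicator (Icc 0 (max s t)) (a i j)) :=
        ((hW i j hij).2.2 (max s t)).integrable_indicator measurableSet_Icc
      refine (h1.intervalIntegrable (a := s) (b := t)).congr (fun r hr => ?_)
      have hr2 : r ≤ max s t := (mem_uIoc.1 hr).elim (fun h => h.2.trans (le_max_right _ _))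
        (fun h => h.2.trans (le_max_left _ _))
      by_cases h0 : r < 0
      · simp [nb, h0, indicator]
      · simp [nb, h0, indicator, hij, hr2, not_lt.1 h0]
  · exact Measurable.ite measurableSet_Iio measurable_const (hD i j).1
  · unfold nh; split_ifs with h1
    · exact le_rfl
    · exact ((hD i j).2 s (not_lt.1 h1)).1
  · unfold nh; split_ifs with h1
    · exact hbar0
    · exact ((hD i j).2 s (not_lt.1 h1)).2

lemma rhs_eq (a h : V → V → ℝ → ℝ) (x : ℝ → V → ℝ) (i : V) {s : ℝ} (hs : 0 ≤ s) :
    rhs a h x i s = FF (nb a) (nh h) x i s := by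
  unfold rhs FF
  rw [← Finset.sum_erase Finset.univ (a := i) (by simp [nb_self])]
  refine Finset.sum_congr rfl fun j hj => ?_
  rw [nb_eq (Finset.ne_of_mem_erase hj).symm hs, nh_eq hs]

lemma nb_integral (a : V → V → ℝ → ℝ) {i j : V} (hij : i ≠ j) {s t : ℝ} (hs : 0 ≤ s) (hst : s ≤ t) :
    ∫ r in s..t, nb a i j r = ∫ r in s..t, a i j r := by
  refine intervalIntegral.integral_congr fun r hr => ?_
  rw [uIcc_of_le hst] at hr
  exact nb_eq hij (hs.trans hr.1)

/-- Every solution yields a continuous, bounded one. -/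
lemma gsol_of {a h : V → V → ℝ → ℝ} {hbar : ℝ} (hW : Weights a) (hbar0 : 0 ≤ hbar)
    (hD : Delays h hbar) {tstar : ℝ} (ht : 0 ≤ tstar) {x : ℝ → V → ℝ}
    (hx : IsSol a h hbar tstar x) :
    ∃ β, GSol (nb a) (nh h) (fun s => x (max s tstar)) (tstar + hbar) β := by
  have hc := core_of hW hbar0 hD
  have hP : ∀ i, ∀ T ≥ tstar, Prim (fun t => x t i) (rhs a h x i) tstar T := fun i T hT =>
    ⟨(hx.2.2 i T hT).1, fun t ht => (hx.2.2 i t ht.1).2⟩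
  have hcont : ∀ i, Continuous fun s => x (max s tstar) i := by
    intro i
    have h1 : ContinuousOn (fun t => x t i) (Ici tstar) := by
      intro t ht
      have h2 := (hP i (t + 1) (by linarith [mem_Ici.1 ht])).continuousOn
        (by linarith [mem_Ici.1 ht]) t ⟨ht, by linarith⟩
      refine h2.mono_of_mem_nhdsWithin ?_
      rw [← Ici_inter_Iic]
      exact inter_mem self_mem_nhdsWithin (mem_nhdsWithin_of_mem_nhds (Iic_mem_nhds (by linarith)))
    exact h1.comp_continuous (continuous_id.max continuous_const) fun s => mem_Ici.2 (le_max_right _ _)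
  have hbd : ∀ i, ∃ B, ∀ s ∈ Icc tstar (tstar + hbar), ‖x (max s tstar) i‖ ≤ B := fun i =>
    isCompact_Icc.exists_bound_of_continuousOn (hcont i).continuousOn
  choose B hB using hbd
  set β := ∑ i, |B i| with hβ
  have hBβ : ∀ i, B i ≤ β := fun i => (le_abs_self _).trans
    (Finset.single_le_sum (f := fun i => |B i|) (fun i _ => abs_nonneg _) (Finset.mem_univ i))
  have hearly : ∀ s ≤ tstar + hbar, ∀ i, |x (max s tstar) i| ≤ β := by
    intro s hs i
    have := hB i (max s tstar) ⟨le_max_right _ _, max_le hs (by linarith)⟩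
    rw [max_eq_left (le_max_right s tstar)] at this
    exact this.trans (hBβ i)
  have heq : ∀ i, ∀ T ≥ tstar + hbar, Prim (fun t => x (max t tstar) i)
      (FF (nb a) (nh h) (fun s => x (max s tstar)) i) (tstar + hbar) T := by
    intro i T hT
    have h1 := (hP i T (by linarith)).mono (s := tstar + hbar) (by linarith) hT le_rfl
    refine (h1.congr (fun t ht => ?_) hT).congr_ig (fun t ht => ?_) hT
    · rw [max_eq_left (by linarith [ht.1])]
    · rw [rhs_eq a h x i (by linarith [ht.1])]
      refine Finset.sum_congr rfl fun j _ => ?_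
      have := hc.h1 i j t
      have e1 : max (t - nh h i j t) tstar = t - nh h i j t := max_eq_left (by linarith [ht.1])
      have e2 : max t tstar = t := max_eq_left (by linarith [ht.1])
      simp only [e1, e2]
  refine ⟨β, hcont, fun t i => ?_, heq⟩
  by_cases htt : t ≤ tstar + hbar
  · exact hearly t htt i
  have hT := (not_le.1 htt).le
  have k1 := hc.setMP Finset.univ (x := fun s => x (max s tstar))
    (ρ := fun t i => FF (nb a) (nh h) (fun s => x (max s tstar)) i t) (θ := -β) (f := fun _ => 0) hT
    (fun i _ => heq i t hT) intervalIntegrable_const (fun _ _ => le_rfl)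
    (fun j _ r hr => (abs_le.1 (hearly r hr.2 j)).1)
    (fun i _ r hr => by simp only [FF, sub_zero]; exact le_rfl) i (Finset.mem_univ i) t ⟨hT, le_rfl⟩
  have k2 := hc.setMP Finset.univ (x := fun s i => -x (max s tstar) i)
    (ρ := fun t i => -FF (nb a) (nh h) (fun s => x (max s tstar)) i t) (θ := -β)
    (f := fun _ => 0) hT
    (fun i _ => (heq i t hT).neg) intervalIntegrable_const (fun _ _ => le_rfl)
    (fun j _ r hr => neg_le_neg (abs_le.1 (hearly r hr.2 j)).2)
    (fun i _ r hr => by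
      simp only [FF, sub_zero, ← Finset.sum_neg_distrib]
      exact Finset.sum_le_sum fun j _ => le_of_eq (by ring)) i (Finset.mem_univ i) t ⟨hT, le_rfl⟩
  simp only [intervalIntegral.integral_zero, sub_zero] at k1 k2
  exact abs_le.2 ⟨k1, by linarith⟩

lemma win_bound {a h : V → V → ℝ → ℝ} {hbar : ℝ} (hU : ULI a)
    (hc : Core (nb a) (nh h) hbar) {D : ℝ} (hD : 0 < D) :
    ∃ M ≥ (0:ℝ), ∀ s ≥ (0:ℝ), ∀ t, s ≤ t → t ≤ s + D → ∀ i j, ∫ r in s..t, nb a i j r ≤ M := by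
  obtain ⟨M, hM⟩ := hU D hD
  refine ⟨max M 0, le_max_right _ _, fun s hs t hst htD i j => ?_⟩
  by_cases hij : i = j
  · subst hij; simp [nb_self]
  · refine le_trans (intervalIntegral.integral_mono_interval le_rfl hst htD
      (Eventually.of_forall fun r => hc.b0 i j r) (hc.bi i j _ _)) ?_
    rw [nb_integral a hij hs (by linarith)]
    exact (hM s hs i j hij).trans (le_max_left _ _)

lemma AA_bound {b h : V → V → ℝ → ℝ} {hbar : ℝ} (hc : Core b h hbar) {s t M : ℝ}
    (hM : ∀ i j, ∫ r in s..t, b i j r ≤ M) (i : V) :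
    ∫ r in s..t, AA b i r ≤ Fintype.card V * M := by
  simp only [AA]
  rw [intervalIntegral.integral_finsetSum (fun j _ => hc.bi i j s t)]
  refine (Finset.sum_le_card_nsmul _ _ M fun j _ => hM i j).trans (le_of_eq ?_)
  simp

/-- Construction of the merged blocks. -/
lemma exists_blocks {a h : V → V → ℝ → ℝ} {hbar : ℝ} (hN : NITS a) (hU : ULI a)
    (hc : Core (nb a) (nh h) hbar) :
    ∃ C ≥ (0:ℝ), ∃ K ≥ (1:ℝ), ∀ T0 : ℝ, ∃ τ : ℕ → ℝ, (∀ p, Blk (nb a) hbar C K (τ p) (τ (p+1))) ∧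
      T0 ≤ τ 0 ∧ 0 ≤ τ 0 ∧ Tendsto τ atTop atTop := by
  obtain ⟨K, hK, tp, ⟨hmono, hlim, h00⟩, ⟨L, hL⟩, hsym⟩ := hN
  have hbar0 := hc.hbar0
  obtain ⟨M, hM0, hM⟩ := win_bound hU hc (D := hbar + 1) (by linarith)
  have htp0 : ∀ p, 0 ≤ tp p := fun p => h00.trans (hmono.monotone (Nat.zero_le p))
  have hL' : ∀ p i j, ∫ r in (tp p)..(tp (p+1)), nb a i j r ≤ max L 0 := by
    intro p i j
    by_cases hij : i = j
    · subst hij; simp [nb_self]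
    · rw [nb_integral a hij (htp0 p) (hmono.monotone (Nat.le_succ p))]
      exact (hL p i j hij).trans (le_max_left _ _)
  have hsym' : ∀ p i j, ∫ r in (tp p)..(tp (p+1)), nb a i j r ≤
      K * ∫ r in (tp p)..(tp (p+1)), nb a j i r := by
    intro p i j
    by_cases hij : i = j
    · subst hij; simp [nb_self]
    · have hle := hmono.monotone (Nat.le_succ p)
      rw [nb_integral a hij (htp0 p) hle, nb_integral a (Ne.symm hij) (htp0 p) hle]
      exact (hsym p i j).2
  have hnext : ∀ p, ∃ q ≥ p, tp q < tp p + (hbar + 1) ∧ tp p + (hbar + 1) ≤ tp (q + 1) := by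
    intro p
    have hex : ∃ r, tp p + (hbar + 1) ≤ tp r := ((tendsto_atTop.1 hlim) _).exists
    classical
    have hspec := Nat.find_spec hex
    have hmin := fun m => Nat.find_min hex (m := m)
    set r := Nat.find hex
    have hpr : p < r := by
      by_contra hcon
      have := hmono.monotone (not_lt.1 hcon)
      linarith
    obtain ⟨q, hq⟩ : ∃ q, r = q + 1 := ⟨r - 1, by omega⟩
    refine ⟨q, by omega, not_le.1 (hmin q (by omega)), by rw [← hq]; exact hspec⟩
  choose nx hnx1 hnx2 hnx3 using hnext
  refine ⟨Fintype.card V * (M + max L 0), by positivity, K, hK, fun T0 => ?_⟩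
  obtain ⟨p0, hp0⟩ := ((tendsto_atTop.1 hlim) T0).exists
  set P : ℕ → ℕ := fun k => Nat.rec p0 (fun _ p => nx p + 1) k with hP
  have hPs : ∀ k, P (k+1) = nx (P k) + 1 := fun k => rfl
  have hstep : ∀ k, tp (P k) + (hbar + 1) ≤ tp (P (k+1)) := fun k => by
    rw [hPs]; exact hnx3 _
  refine ⟨fun k => tp (P k), fun k => ⟨?_, ?_, ?_⟩, hp0, htp0 _, ?_⟩
  · linarith [hstep k]
  · refine AA_bound hc fun i j => ?_
    show ∫ r in (tp (P k))..(tp (P (k+1))), nb a i j r ≤ M + max L 0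
    rw [hPs, ← intervalIntegral.integral_add_adjacent_intervals
      (hc.bi i j (tp (P k)) (tp (nx (P k)))) (hc.bi i j _ _)]
    have h1 := hM (tp (P k)) (htp0 _) (tp (nx (P k))) (hmono.monotone (hnx1 _)) (hnx2 _).le i j
    linarith [hL' (nx (P k)) i j]
  · intro i j
    have hle : P k ≤ P (k+1) := by rw [hPs]; have := hnx1 (P k); omega
    rw [← intervalIntegral.sum_integral_adjacent_intervals_Ico hle (fun _ _ => hc.bi i j _ _),
      ← intervalIntegral.sum_integral_adjacent_intervals_Ico hle (fun _ _ => hc.bi j i _ _),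
      Finset.mul_sum]
    exact Finset.sum_le_sum fun p _ => hsym' p i j
  · have hk : ∀ k : ℕ, tp (P 0) + k ≤ tp (P k) := by
      intro k
      induction k with
      | zero => simp
      | succ k ih => have := hstep k; push_cast; linarith
    exact tendsto_atTop_mono hk (tendsto_atTop_add_const_left _ _ tendsto_natCast_atTop_atTop)

/-- Integrability from bounded primitives. -/
lemma integrable_of_bound {b h : V → V → ℝ → ℝ} {hbar : ℝ} (hc : Core b h hbar) (i j : V)
    {T B : ℝ} {τ : ℕ → ℝ} (hτ : Tendsto τ atTop atTop)
    (hB : ∀ N, T ≤ τ N → ∫ s in T..(τ N), b i j s ≤ B) (S : ℝ) : IntegrableOn (b i j) (Ioi S) := by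
  have h1 : IntegrableOn (b i j) (Ioi T) := by
    refine integrableOn_Ioi_of_intervalIntegral_norm_bounded B T (b := τ) (l := atTop)
      (fun N => ?_) hτ ?_
    · by_cases hN : T ≤ τ N
      · exact (intervalIntegrable_iff_integrableOn_Ioc_of_le hN).1 (hc.bi i j _ _)
      · rw [Ioc_eq_empty (fun h => hN h.le)]; exact integrableOn_empty
    · filter_upwards [hτ.eventually (eventually_ge_atTop T)] with N hN
      have : ∀ s, ‖b i j s‖ = b i j s := fun s => Real.norm_of_nonneg (hc.b0 i j s)
      simp only [this]
      exact hB N hN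
  have h2 : IntegrableOn (b i j) (Ioc S (max S T)) :=
    (intervalIntegrable_iff_integrableOn_Ioc_of_le (le_max_left _ _)).1 (hc.bi i j _ _)
  refine (h2.union h1).mono_set fun s hs => ?_
  by_cases hsT : s ≤ max S T
  · exact Or.inl ⟨hs, hsT⟩
  · exact Or.inr ((le_max_right S T).trans_lt (not_le.1 hsT))

lemma parc_iff {a h : V → V → ℝ → ℝ} {hbar : ℝ}
    (hc : Core (nb a) (nh h) hbar) {i j : V} (hij : i ≠ j) :
    PArc a j i ↔ ¬ IntegrableOn (nb a i j) (Ioi 0) := by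
  have h1 : ∫⁻ t in Ioi (0:ℝ), ENNReal.ofReal (a i j t) =
      ∫⁻ t in Ioi (0:ℝ), ENNReal.ofReal (nb a i j t) :=
    setLIntegral_congr_fun measurableSet_Ioi fun t ht => by
      simp only [nb_eq hij (le_of_lt (mem_Ioi.1 ht))]
  unfold PArc
  rw [h1, IntegrableOn, ← lintegral_ofReal_ne_top_iff_integrable
    (hc.bm i j).aestronglyMeasurable (Eventually.of_forall fun t => hc.b0 i j t)]
  simp [Ne.symm hij]

/-- Convergence and agreement along persistent arcs. -/
lemma sol_props {a h : V → V → ℝ → ℝ} {hbar : ℝ} (hW : Weights a) (hN : NITS a) (hU : ULI a)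
    (hbar0 : 0 ≤ hbar) (hD : Delays h hbar) {tstar : ℝ} (ht : 0 ≤ tstar) {x : ℝ → V → ℝ}
    (hx : IsSol a h hbar tstar x) :
    ∃ c : V → ℝ, (∀ i, Tendsto (fun t => x t i) atTop (𝓝 (c i))) ∧
      ∀ i j, PArc a j i → c i = c j := by
  have hc := core_of hW hbar0 hD
  obtain ⟨β, hg⟩ := gsol_of hW hbar0 hD ht hx
  obtain ⟨C, hC, K, hK, hblk⟩ := exists_blocks hN hU hc
  obtain ⟨τ, hτ, hτT, hτ0, hτl⟩ := hblk (tstar + hbar)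
  obtain ⟨R, hR⟩ := hc.energy hg hC hK hτ hτT hτl
  obtain ⟨M, hM0, hM⟩ := win_bound hU hc (D := hbar + 1) (by linarith)
  have hconv := hc.converge hg hτT hR (M := Fintype.card V * M) (by positivity)
    (fun t ht i => AA_bound hc (hM t (hτ0.trans ht) (t + hbar) (by linarith) (by linarith)) i)
  choose c hcl using hconv
  refine ⟨c, fun i => ?_, fun i j hp => ?_⟩
  · refine (hcl i).congr' ?_
    filter_upwards [eventually_ge_atTop tstar] with t ht
    rw [max_eq_left ht]
  · by_contra hne
    obtain ⟨T, B, hB⟩ := hc.finite_weight hg hR (hcl i) (hcl j) hne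
    exact (parc_iff hc hp.1.symm).1 hp (integrable_of_bound hc i j hτl (fun N hN => hB _ hN) 0)

/-- A group of agents with small inflow keeps its level. -/
lemma hold {b h : V → V → ℝ → ℝ} {hbar : ℝ} (hc : Core b h hbar) (U : Finset V)
    {z : ℝ → V → ℝ} {T t θ : ℝ} (hT : T ≤ t)
    (hz : ∀ i, Prim (fun t => z t i) (FF b h z i) T t)
    (hosc : ∀ s r i j, -1 ≤ z s j - z r i) {f : ℝ → ℝ}
    (hf : IntervalIntegrable f volume T t) (hf0 : ∀ s, 0 ≤ f s)
    (hfb : ∀ i ∈ U, ∀ s, ∑ j ∈ Uᶜ, b i j s ≤ f s)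
    (h0 : ∀ j ∈ U, ∀ r ≤ T, θ ≤ z r j) :
    ∀ i ∈ U, θ - ∫ s in T..t, f s ≤ z t i := by
  intro i hi
  refine hc.setMP U (x := z) (ρ := fun t i => FF b h z i t) hT (fun i _ => hz i) hf
    (fun s _ => hf0 s) (fun j hj r hr => h0 j hj r hr.2) (fun i hi s _ => ?_) i hi t ⟨hT, le_rfl⟩
  have h1 : FF b h z i s = ∑ j ∈ U, b i j s * (z (s - h i j s) j - z s i) +
      ∑ j ∈ Uᶜ, b i j s * (z (s - h i j s) j - z s i) :=
    (Finset.sum_add_sum_compl U _).symm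
  have h2 : -∑ j ∈ Uᶜ, b i j s ≤ ∑ j ∈ Uᶜ, b i j s * (z (s - h i j s) j - z s i) := by
    rw [← Finset.sum_neg_distrib]
    refine Finset.sum_le_sum fun j _ => ?_
    have := mul_le_mul_of_nonneg_left (hosc (s - h i j s) s i j) (hc.b0 i j s)
    linarith
  have h3 := hfb i hi s
  simp only [h1]
  linarith

/-- Under type symmetry, integrability is symmetric. -/
lemma integrable_symm {a h : V → V → ℝ → ℝ} {hbar : ℝ} (hN : NITS a) (hU : ULI a)
    (hc : Core (nb a) (nh h) hbar) {u v : V} (hi : IntegrableOn (nb a v u) (Ioi 0)) :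
    IntegrableOn (nb a u v) (Ioi 0) := by
  obtain ⟨C, hC, K, hK, hblk⟩ := exists_blocks hN hU hc
  obtain ⟨τ, hτ, hτT, hτ0, hτl⟩ := hblk 0
  refine integrable_of_bound hc u v (T := τ 0) (B := K * ∫ s in Ioi 0, nb a v u s) hτl
    (fun N hN => ?_) 0
  have h1 : ∫ s in (τ 0)..(τ N), nb a u v s ≤ K * ∫ s in (τ 0)..(τ N), nb a v u s := by
    rw [← intervalIntegral.sum_integral_adjacent_intervals (fun _ _ => hc.bi u v _ _),
      ← intervalIntegral.sum_integral_adjacent_intervals (fun _ _ => hc.bi v u _ _),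
      Finset.mul_sum]
    exact Finset.sum_le_sum fun p _ => (hτ p).sym u v
  refine h1.trans (mul_le_mul_of_nonneg_left ?_ (by linarith))
  rw [intervalIntegral.integral_of_le hN]
  exact setIntegral_mono_set hi (Eventually.of_forall fun s => hc.b0 v u s)
    (Eventually.of_forall fun s hs => hτ0.trans_lt hs.1)

lemma separate {a h : V → V → ℝ → ℝ} {hbar : ℝ} (hW : Weights a) (hN : NITS a) (hU : ULI a)
    (hbar0 : 0 ≤ hbar) (hD : Delays h hbar) {i j : V} (hij : ¬ JoinedG a i j) :
    ∃ tstar ≥ (0:ℝ), ∃ x : ℝ → V → ℝ, IsSol a h hbar tstar x ∧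
        ∃ ci cj : ℝ, Tendsto (fun t => x t i) atTop (𝓝 ci) ∧
          Tendsto (fun t => x t j) atTop (𝓝 cj) ∧ ci ≠ cj := by
  classical
  have hc := core_of hW hbar0 hD
  set C : Finset V := Finset.univ.filter (fun v => JoinedG a i v) with hCdef
  have hmem : ∀ v, v ∈ C ↔ JoinedG a i v := fun v => by simp [hCdef]
  have hvu : ∀ u ∈ C, ∀ v ∈ Cᶜ, IntegrableOn (nb a v u) (Ioi 0) := by
    intro u hu v hv
    have hv' : v ∉ C := by simpa using hv
    have hne : v ≠ u := fun hh => hv' (hh ▸ hu)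
    by_contra hcon
    exact hv' ((hmem v).2 (((hmem u).1 hu).tail ((parc_iff hc hne).2 hcon)))
  set cr : ℝ → ℝ := fun s => ∑ u ∈ C, ∑ v ∈ Cᶜ, (nb a u v s + nb a v u s) with hcr
  have hcr0 : ∀ s, 0 ≤ cr s := fun s => Finset.sum_nonneg fun u _ => Finset.sum_nonneg fun v _ =>
    add_nonneg (hc.b0 u v s) (hc.b0 v u s)
  have hcri : IntegrableOn cr (Ioi 0) := by
    refine integrable_finsetSum _ fun u hu => integrable_finsetSum _ fun v hv => ?_
    exact (integrable_symm hN hU hc (hvu u hu v hv)).add (hvu u hu v hv)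
  have hcrii : ∀ S T, 0 ≤ S → S ≤ T → IntervalIntegrable cr volume S T := fun S T hS hST => by
    rw [intervalIntegrable_iff_integrableOn_Ioc_of_le hST]
    exact hcri.mono_set fun s hs => hS.trans_lt hs.1
  have hlim := intervalIntegral_tendsto_integral_Ioi (0:ℝ) hcri tendsto_id
  obtain ⟨T, hTc, hT0⟩ : ∃ T, (∫ s in Ioi 0, cr s) - 1/4 < ∫ s in (0:ℝ)..T, cr s ∧ 0 ≤ T :=
    ((hlim.eventually (lt_mem_nhds (by linarith))).and (eventually_ge_atTop 0)).exists
  have hsmall : ∀ t ≥ T, ∫ s in T..t, cr s ≤ 1/4 := by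
    intro t ht
    have h1 := intervalIntegral.integral_add_adjacent_intervals (hcrii 0 T le_rfl hT0)
      (hcrii T t hT0 ht)
    have h2 : ∫ s in (0:ℝ)..t, cr s ≤ ∫ s in Ioi 0, cr s := by
      rw [intervalIntegral.integral_of_le (hT0.trans ht)]
      exact setIntegral_mono_set hcri (Eventually.of_forall hcr0)
        (Eventually.of_forall fun s hs => hs.1)
    linarith
  set ξ : V → ℝ := fun v => if v ∈ C then 1 else 0 with hξ
  have hξ0 : ∀ v, 0 ≤ ξ v := fun v => by simp only [hξ]; split_ifs <;> norm_num
  have hξ1 : ∀ v, ξ v ≤ 1 := fun v => by simp only [hξ]; split_ifs <;> norm_num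
  obtain ⟨y, hym, hy0, hy1, hyl, hyT, hyP⟩ := hc.exists_sol T hξ0 hξ1 hξ0 hξ1
  have hyinit : ∀ r ≤ T, ∀ v, y r v = ξ v := by
    intro r hr v
    rcases hr.lt_or_eq with h1 | h1
    · exact hyl r h1 v
    · rw [h1]; exact hyT v
  have hsol : IsSol a h hbar T y := by
    refine ⟨fun v => (hym v).aestronglyMeasurable, ⟨1, fun s _ v => ?_⟩, fun v t ht => ?_⟩
    · rw [abs_of_nonneg (hy0 s v)]; exact hy1 s v
    · have := (hyP v t ht).congr_ig (γ := rhs a h y v)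
        (fun s hs => rhs_eq a h y v (hT0.trans hs.1)) ht
      exact ⟨this.1, this.2 t ⟨ht, le_rfl⟩⟩
  obtain ⟨c, hcl, -⟩ := sol_props hW hN hU hbar0 hD hT0 hsol
  have hup : ∀ t ≥ T, 3/4 ≤ y t i := by
    intro t ht
    have := hold hc C (z := y) (θ := 1) ht (fun v => hyP v t ht)
      (fun s r u v => by linarith [hy0 s v, hy1 r u]) (hcrii T t hT0 ht) hcr0
      (fun u hu s => ?_) (fun u hu r hr => by rw [hyinit r hr]; simp [hξ, hu])
      i ((hmem i).2 Relation.ReflTransGen.refl)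
    · linarith [hsmall t ht]
    · refine le_trans (Finset.sum_le_sum fun v _ => ?_) (Finset.single_le_sum
        (f := fun u => ∑ v ∈ Cᶜ, (nb a u v s + nb a v u s)) (fun u _ => Finset.sum_nonneg fun v _ =>
        add_nonneg (hc.b0 u v s) (hc.b0 v u s)) hu)
      linarith [hc.b0 v u s]
  have hdn : ∀ t ≥ T, y t j ≤ 1/4 := by
    intro t ht
    have := hold hc Cᶜ (z := fun s v => -y s v) (θ := 0) ht
      (fun v => (hyP v t ht).neg.congr_ig (fun s _ => ?_) ht)
      (fun s r u v => by linarith [hy0 r u, hy1 s v]) (hcrii T t hT0 ht) hcr0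
      (fun v hv s => ?_) (fun u hu r hr => ?_)
      j (by simpa [hmem] using hij)
    · linarith [hsmall t ht]
    · simp only [FF, ← Finset.sum_neg_distrib]
      exact Finset.sum_congr rfl fun w _ => by ring
    · rw [compl_compl]
      refine Finset.sum_le_sum fun u _ => ?_
      refine le_trans ?_ (Finset.single_le_sum (f := fun v => nb a u v s + nb a v u s)
        (fun v _ => add_nonneg (hc.b0 u v s) (hc.b0 v u s)) hv)
      linarith [hc.b0 u v s]
    · simp only [hyinit r hr]
      have : u ∉ C := by simpa using hu
      simp [hξ, this]
  refine ⟨T, hT0, y, hsol, c i, c j, hcl i, hcl j, fun heq => ?_⟩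
  have h1 : 3/4 ≤ c i := ge_of_tendsto (hcl i) ((eventually_ge_atTop T).mono hup)
  have h2 : c j ≤ 1/4 := le_of_tendsto (hcl j) ((eventually_ge_atTop T).mono hdn)
  linarith

theorem stmt2
    (a : V → V → ℝ → ℝ) (hW : Weights a) (hN : NITS a) (hU : ULI a)
    (hbar : ℝ) (hbar0 : 0 ≤ hbar) (h : V → V → ℝ → ℝ) (hD : Delays h hbar) :
    (∀ tstar ≥ (0:ℝ), ∀ x : ℝ → V → ℝ, IsSol a h hbar tstar x →
      ∀ i : V, ∃ ci : ℝ, Tendsto (fun t => x t i) atTop (𝓝 ci)) ∧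
    (∀ i j : V, JoinedG a i j →
      ∀ tstar ≥ (0:ℝ), ∀ x : ℝ → V → ℝ, IsSol a h hbar tstar x →
        ∃ c : ℝ, Tendsto (fun t => x t i) atTop (𝓝 c) ∧
          Tendsto (fun t => x t j) atTop (𝓝 c)) ∧
    (∀ i j : V, ¬ JoinedG a i j →
      ∃ tstar ≥ (0:ℝ), ∃ x : ℝ → V → ℝ, IsSol a h hbar tstar x ∧
        ∃ ci cj : ℝ, Tendsto (fun t => x t i) atTop (𝓝 ci) ∧
          Tendsto (fun t => x t j) atTop (𝓝 cj) ∧ ci ≠ cj) ∧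
    ((∀ tstar ≥ (0:ℝ), ∀ x : ℝ → V → ℝ, IsSol a h hbar tstar x →
        ∃ c : ℝ, ∀ i : V, Tendsto (fun t => x t i) atTop (𝓝 c)) ↔
      ∀ i j : V, JoinedG a i j) := by
  have hjoin : ∀ i j : V, JoinedG a i j → ∀ c : V → ℝ, (∀ i j, PArc a j i → c i = c j) →
      c i = c j := by
    intro i j hj c hcc
    induction hj with
    | refl => rfl
    | tail _ h2 ih => exact ih.trans (hcc _ _ h2).symm
  refine ⟨fun T hT x hx i => ?_, fun i j hj T hT x hx => ?_, fun i j hj => ?_, fun hall i j => ?_,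
    fun hall T hT x hx => ?_⟩
  · obtain ⟨c, hcl, -⟩ := sol_props hW hN hU hbar0 hD hT hx
    exact ⟨c i, hcl i⟩
  · obtain ⟨c, hcl, hcc⟩ := sol_props hW hN hU hbar0 hD hT hx
    refine ⟨c i, hcl i, ?_⟩
    rw [hjoin i j hj c hcc]
    exact hcl j
  · exact separate hW hN hU hbar0 hD hj
  · by_contra hj
    obtain ⟨T, hT, x, hx, ci, cj, hi, hj', hne⟩ := separate hW hN hU hbar0 hD hj
    obtain ⟨c, hcl⟩ := hall T hT x hx
    exact hne ((tendsto_nhds_unique hi (hcl i)).trans (tendsto_nhds_unique hj' (hcl j)).symm)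
  · obtain ⟨c, hcl, hcc⟩ := sol_props hW hN hU hbar0 hD hT hx
    by_cases hV : Nonempty V
    · obtain ⟨i0⟩ := hV
      refine ⟨c i0, fun i => ?_⟩
      rw [hjoin i0 i (hall i0 i) c hcc]
      exact hcl i
    · exact ⟨0, fun i => (hV ⟨i⟩).elim⟩
end

section
/- Fix measurable locally integrable weights a_ij and gains d_i : [0,∞) → [0,∞), and measurable delays h_ij(t) ∈ [0,h̄]. The target aggregation algorithm provides aggregation for every target data — i.e., for every dimension m ≥ 1, every nonempty closed convex set Ω ⊆ ℝ^m, every measurable locally integrable functions ω_i : [0,∞) → Ω and every solution of the aggregation dynamics, dist(x_i(t), Ω) → 0 as t → ∞ for all i ∈ V — if and only if the damped averaging dynamics with gains d_i are asymptotically stable, i.e., every scalar solution of the damped dynamics converges to 0. -/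
open MeasureTheory Filter Topology Set

variable {V : Type*} [Fintype V] [DecidableEq V]

/-- Admissible damping gains. -/
def Gains (d : V → ℝ → ℝ) : Prop :=
  ∀ i : V, Measurable (d i) ∧ (∀ t ≥ (0:ℝ), 0 ≤ d i t) ∧
    ∀ T : ℝ, IntegrableOn (d i) (Icc 0 T)

/-- Right-hand side of the damped averaging dynamics. -/
def rhsDamp (a h : V → V → ℝ → ℝ) (d : V → ℝ → ℝ) (x : ℝ → V → ℝ) (i : V) (s : ℝ) : ℝ :=
  -(d i s * x s i) + ∑ j ∈ Finset.univ.erase i, a i j s * (x (s - h i j s) j - x s i)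

/-- A solution of the damped averaging dynamics. -/
def IsSolDamp (a h : V → V → ℝ → ℝ) (d : V → ℝ → ℝ) (hbar tstar : ℝ) (x : ℝ → V → ℝ) : Prop :=
  (∀ i : V, AEStronglyMeasurable (fun s => x s i) (volume.restrict (Icc (tstar - hbar) tstar))) ∧
  (∃ M : ℝ, ∀ s ∈ Icc (tstar - hbar) tstar, ∀ i : V, |x s i| ≤ M) ∧
  ∀ i : V, ∀ t ≥ tstar,
    IntervalIntegrable (rhsDamp a h d x i) volume tstar t ∧
    x t i = x tstar i + ∫ s in tstar..t, rhsDamp a h d x i s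

/-- Right-hand side of the target-aggregation dynamics. -/
noncomputable def rhsAgg (m : ℕ) (a h : V → V → ℝ → ℝ) (d : V → ℝ → ℝ)
    (w : V → ℝ → EuclideanSpace ℝ (Fin m)) (x : ℝ → V → EuclideanSpace ℝ (Fin m))
    (i : V) (s : ℝ) : EuclideanSpace ℝ (Fin m) :=
  (∑ j ∈ Finset.univ.erase i, a i j s • (x (s - h i j s) j - x s i)) +
    d i s • (w i s - x s i)

/-- A solution of the target-aggregation dynamics. -/
def IsSolAgg (m : ℕ) (a h : V → V → ℝ → ℝ) (d : V → ℝ → ℝ)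
    (w : V → ℝ → EuclideanSpace ℝ (Fin m)) (hbar tstar : ℝ)
    (x : ℝ → V → EuclideanSpace ℝ (Fin m)) : Prop :=
  (∀ i : V, AEStronglyMeasurable (fun s => x s i) (volume.restrict (Icc (tstar - hbar) tstar))) ∧
  (∃ M : ℝ, ∀ s ∈ Icc (tstar - hbar) tstar, ∀ i : V, ‖x s i‖ ≤ M) ∧
  ∀ i : V, ∀ t ≥ tstar,
    IntervalIntegrable (rhsAgg m a h d w x i) volume tstar t ∧
    x t i = x tstar i + ∫ s in tstar..t, rhsAgg m a h d w x i s


lemma agg_no_touch {ψ f b : ℝ → ℝ} {t0 t1 : ℝ} (h01 : t0 < t1)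
    (hf : IntervalIntegrable f volume t0 t1) (hb : IntervalIntegrable b volume t0 t1)
    (hψ : ∀ t ∈ Icc t0 t1, ψ t = ψ t0 + ∫ s in t0..t, f s)
    (hb0 : ∀ t ∈ Icc t0 t1, 0 ≤ b t)
    (hfb : ∀ t ∈ Icc t0 t1, f t ≤ - (b t * ψ t))
    (hneg : ∀ t ∈ Ico t0 t1, ψ t < 0) (h1 : 0 ≤ ψ t1) : False := by
  have hsub : ∀ u v, u ∈ Icc t0 t1 → v ∈ Icc t0 t1 → uIcc u v ⊆ uIcc t0 t1 := by
    intro u v hu hv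
    rw [← uIcc_of_le h01.le] at hu hv
    exact uIcc_subset_uIcc hu hv
  have hcont : ContinuousOn ψ (Icc t0 t1) := by
    have := intervalIntegral.continuousOn_primitive_interval' hf (left_mem_uIcc)
    rw [uIcc_of_le h01.le] at this
    exact (continuousOn_const.add this).congr hψ
  have hbc : ContinuousOn (fun t => ∫ s in t1..t, b s) (Icc t0 t1) := by
    have := intervalIntegral.continuousOn_primitive_interval' hb (right_mem_uIcc)
    rwa [uIcc_of_le h01.le] at this
  have hev : ∀ᶠ t in 𝓝[<] t1, (∫ s in t1..t, b s) > -(1/2) := by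
    have h2 : Tendsto (fun t => ∫ s in t1..t, b s) (𝓝[<] t1) (𝓝 0) := by
      have := hbc t1 ⟨h01.le, le_rfl⟩
      unfold ContinuousWithinAt at this
      simp only [intervalIntegral.integral_same] at this
      refine this.mono_left ?_
      rw [← nhdsWithin_Ioo_eq_nhdsLT h01]
      exact nhdsWithin_mono _ Ioo_subset_Icc_self
    exact h2.eventually (lt_mem_nhds (by norm_num))
  obtain ⟨u, hu, huI⟩ := (hev.and (Ioo_mem_nhdsLT h01)).exists
  have huI' : u ∈ Icc t0 t1 := Ioo_subset_Icc_self huI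
  obtain ⟨s0, hs0, hmin⟩ := isCompact_Icc.exists_isMinOn (nonempty_Icc.2 huI.2.le)
    (hcont.mono (Icc_subset_Icc_left huI.1.le))
  have hs0' : s0 ∈ Icc t0 t1 := ⟨huI.1.le.trans hs0.1, hs0.2⟩
  have hmin' : ∀ t ∈ Icc u t1, ψ s0 ≤ ψ t := fun t ht => hmin ht
  have hs0n : ψ s0 < 0 := (hmin' u ⟨le_rfl, huI.2.le⟩).trans_lt (hneg u ⟨huI.1.le, huI.2⟩)
  have e1 : ψ t1 - ψ s0 = ∫ s in s0..t1, f s := by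
    rw [hψ t1 ⟨h01.le, le_rfl⟩, hψ s0 hs0',
      ← intervalIntegral.integral_interval_sub_left hf (hf.mono_set (hsub _ _ ⟨le_rfl, h01.le⟩ hs0'))]
    ring
  have hbi : IntervalIntegrable b volume s0 t1 :=
    hb.mono_set (hsub _ _ hs0' ⟨h01.le, le_rfl⟩)
  have hbu : IntervalIntegrable b volume u s0 :=
    hb.mono_set (hsub _ _ huI' hs0')
  have e2 : (∫ s in s0..t1, f s) ≤ ∫ s in s0..t1, b s * (- ψ s0) := by
    refine intervalIntegral.integral_mono_on hs0.2
      (hf.mono_set (hsub _ _ hs0' ⟨h01.le, le_rfl⟩)) (hbi.mul_const _) ?_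
    intro s hs
    have hsI : s ∈ Icc t0 t1 := ⟨hs0'.1.trans hs.1, hs.2⟩
    have := hfb s hsI
    have := mul_le_mul_of_nonneg_left (hmin' s ⟨hs0.1.trans hs.1, hs.2⟩) (hb0 s hsI)
    linarith
  rw [intervalIntegral.integral_mul_const] at e2
  have e3 : (∫ s in s0..t1, b s) ≤ 1/2 := by
    have : (∫ s in u..s0, b s) + (∫ s in s0..t1, b s) = ∫ s in u..t1, b s :=
      intervalIntegral.integral_add_adjacent_intervals hbu hbi
    have h0 : 0 ≤ ∫ s in u..s0, b s := intervalIntegral.integral_nonneg hs0.1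
      (fun s hs => hb0 s ⟨huI.1.le.trans hs.1, hs.2.trans hs0.2⟩)
    rw [intervalIntegral.integral_symm] at hu
    linarith
  nlinarith

lemma agg_support {m : ℕ} {Ω : Set (EuclideanSpace ℝ (Fin m))}
    (hne : Ω.Nonempty) (hcl : IsClosed Ω) (hcv : Convex ℝ Ω) (u : EuclideanSpace ℝ (Fin m)) :
    ∃ e p : EuclideanSpace ℝ (Fin m),
      inner ℝ e (u - p) = Metric.infDist u Ω ∧ (∀ z, inner ℝ e (z - p) ≤ Metric.infDist z Ω) := by
  obtain ⟨p, hp, hpm⟩ := exists_norm_eq_iInf_of_complete_convex hne hcl.isComplete hcv u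
  have hin := (norm_eq_iInf_iff_real_inner_le_zero hcv hp).1 hpm
  have hle : ∀ z, inner ℝ (‖u - p‖⁻¹ • (u - p)) (z - p) ≤ Metric.infDist z Ω := by
    intro z
    refine (Metric.le_infDist hne).2 ?_
    intro q hq
    have h1 : z - p = (z - q) + (q - p) := by abel
    rw [h1, inner_add_right, real_inner_smul_left _ (q - p)]
    have h2 : ‖u - p‖⁻¹ * inner ℝ (u - p) (q - p) ≤ 0 :=
      mul_nonpos_of_nonneg_of_nonpos (by positivity) (hin q hq)
    have h3 := real_inner_le_norm (‖u - p‖⁻¹ • (u - p)) (z - q)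
    have h4 : ‖(‖u - p‖⁻¹ • (u - p))‖ ≤ 1 := by
      rw [norm_smul, norm_inv, norm_norm]
      exact inv_mul_le_one
    have h5 := mul_le_mul_of_nonneg_right h4 (norm_nonneg (z - q))
    rw [dist_eq_norm]
    linarith
  refine ⟨‖u - p‖⁻¹ • (u - p), p, le_antisymm (hle u) ?_, hle⟩
  rw [real_inner_smul_left, real_inner_self_eq_norm_sq]
  have : Metric.infDist u Ω ≤ ‖u - p‖ := by
    rw [← dist_eq_norm]; exact Metric.infDist_le_dist_of_mem hp
  refine this.trans (le_of_eq ?_)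
  by_cases h0 : ‖u - p‖ = 0
  · simp [h0]
  · field_simp

lemma agg_pow_integral {c : ℝ → ℝ} (hc : ∀ u v, IntervalIntegrable c volume u v) (t0 t : ℝ)
    (n : ℕ) :
    (∫ s in t0..t, c s * (∫ r in t0..s, c r) ^ n) = (∫ r in t0..t, c r) ^ (n+1) / (n+1) := by
  have hac : AbsolutelyContinuousOnInterval (fun s => ∫ r in t0..s, c r) t0 t :=
    (hc t0 t).absolutelyContinuousOnInterval_intervalIntegral left_mem_uIcc
  have hacp : ∀ k : ℕ, AbsolutelyContinuousOnInterval
      (fun s => (∫ r in t0..s, c r) ^ (k+1)) t0 t := by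
    intro k
    induction k with
    | zero => simpa using hac
    | succ k ih =>
      simp_rw [pow_succ _ (k+1)]
      exact ih.fun_mul hac
  have h1 := (hacp n).integral_deriv_eq_sub
  simp only [intervalIntegral.integral_same, ne_eq, Nat.add_eq_zero_iff, one_ne_zero, and_false,
    not_false_eq_true, zero_pow, sub_zero] at h1
  rw [← h1, eq_div_iff (by positivity), ← intervalIntegral.integral_mul_const]
  apply intervalIntegral.integral_congr_ae
  filter_upwards [(hc t0 t).ae_hasDerivAt_integral] with s hs hs1
  have := (hs (uIoc_subset_uIcc hs1) t0 left_mem_uIcc).pow (n+1)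
  have h2 := this.deriv
  simp only [Pi.pow_def, Nat.add_sub_cancel, Nat.cast_add, Nat.cast_one] at h2
  rw [h2]; ring

/-- Picard iterates of the damped dynamics, started at the constant `M`. -/
noncomputable def dampPicard (a h : V → V → ℝ → ℝ) (d : V → ℝ → ℝ) (t0 M : ℝ) :
    ℕ → ℝ → V → ℝ
  | 0 => fun _ _ => M
  | n + 1 => fun t i => ∫ s in t0..(max t t0), rhsDamp a h d (dampPicard a h d t0 M n) i s

/-- A locally integrable coefficient dominating the damped dynamics. -/
noncomputable def dampCoef (a : V → V → ℝ → ℝ) (d : V → ℝ → ℝ) : ℝ → ℝ :=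
  indicator (Ici 0) (fun s => ∑ i, (d i s + ∑ j ∈ Finset.univ.erase i, 2 * a i j s))

lemma dampCoef_nonneg {a : V → V → ℝ → ℝ} (hW : Weights a) {d : V → ℝ → ℝ} (hd : Gains d) (s : ℝ) :
    0 ≤ dampCoef a d s := by
  refine indicator_nonneg (fun s hs => Finset.sum_nonneg fun i _ => ?_) s
  refine add_nonneg ((hd i).2.1 s hs) (Finset.sum_nonneg fun j hj => ?_)
  have := (hW i j (Finset.ne_of_mem_erase hj).symm).2.1 s hs
  positivity

lemma dampCoef_int {a : V → V → ℝ → ℝ} (hW : Weights a) {d : V → ℝ → ℝ} (hd : Gains d) (u v : ℝ) :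
    IntervalIntegrable (dampCoef a d) volume u v := by
  have h1 : IntegrableOn (fun s => ∑ i, (d i s + ∑ j ∈ Finset.univ.erase i, 2 * a i j s))
      (Icc 0 (max u v)) := by
    refine integrable_finsetSum _ fun i _ => Integrable.add ((hd i).2.2 _) ?_
    refine integrable_finsetSum _ fun j hj => Integrable.const_mul ?_ _
    exact (hW i j (Finset.ne_of_mem_erase hj).symm).2.2 _
  rw [intervalIntegrable_iff]
  unfold dampCoef
  rw [integrableOn_indicator_iff measurableSet_Ici]
  refine h1.mono_set ?_
  rintro s ⟨hs0, hs⟩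
  exact ⟨hs0, hs.2⟩

lemma rhsDamp_meas {a : V → V → ℝ → ℝ} (hW : Weights a) {d : V → ℝ → ℝ} (hd : Gains d)
    {h : V → V → ℝ → ℝ} {hbar : ℝ} (hD : Delays h hbar) {x : ℝ → V → ℝ}
    (hx : ∀ i, Measurable (fun s => x s i)) (i : V) : Measurable (rhsDamp a h d x i) := by
  unfold rhsDamp
  refine (((hd i).1.mul (hx i)).neg).add (Finset.measurable_sum _ fun j hj => ?_)
  refine (hW i j (Finset.ne_of_mem_erase hj).symm).1.mul (Measurable.sub ?_ (hx i))
  exact (hx j).comp (measurable_id.sub (hD i j).1)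

lemma rhsDamp_bound {a : V → V → ℝ → ℝ} (hW : Weights a) {d : V → ℝ → ℝ} (hd : Gains d)
    {h : V → V → ℝ → ℝ} {hbar : ℝ} (hD : Delays h hbar) {x : ℝ → V → ℝ} {s K : ℝ} (hs : 0 ≤ s)
    (hx : ∀ r ≤ s, ∀ i, |x r i| ≤ K) (i : V) :
    |rhsDamp a h d x i s| ≤ dampCoef a d s * K := by
  have hK : 0 ≤ K := (abs_nonneg _).trans (hx s le_rfl i)
  have hterm : ∀ k, 0 ≤ d k s + ∑ j ∈ Finset.univ.erase k, 2 * a k j s := by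
    intro k
    refine add_nonneg ((hd k).2.1 s hs) (Finset.sum_nonneg fun j hj => ?_)
    have := (hW k j (Finset.ne_of_mem_erase hj).symm).2.1 s hs
    positivity
  have h1 : |rhsDamp a h d x i s| ≤ (d i s + ∑ j ∈ Finset.univ.erase i, 2 * a i j s) * K := by
    unfold rhsDamp
    refine (abs_add_le _ _).trans ?_
    rw [add_mul, abs_neg, abs_mul, abs_of_nonneg ((hd i).2.1 s hs), Finset.sum_mul]
    refine add_le_add (mul_le_mul_of_nonneg_left (hx s le_rfl i) ((hd i).2.1 s hs)) ?_
    refine (Finset.abs_sum_le_sum_abs _ _).trans (Finset.sum_le_sum fun j hj => ?_)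
    have ha := (hW i j (Finset.ne_of_mem_erase hj).symm).2.1 s hs
    rw [abs_mul, abs_of_nonneg ha]
    have h2 : |x (s - h i j s) j - x s i| ≤ 2 * K := by
      have e1 := hx (s - h i j s) (by linarith [((hD i j).2 s hs).1]) j
      have e2 := hx s le_rfl i
      rw [abs_le] at *
      constructor <;> linarith
    calc a i j s * |x (s - h i j s) j - x s i| ≤ a i j s * (2 * K) :=
          mul_le_mul_of_nonneg_left h2 ha
      _ = 2 * a i j s * K := by ring
  refine h1.trans (mul_le_mul_of_nonneg_right ?_ hK)
  unfold dampCoef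
  rw [indicator_of_mem (show s ∈ Ici (0:ℝ) from hs)]
  exact Finset.single_le_sum (f := fun k => d k s + ∑ j ∈ Finset.univ.erase k, 2 * a k j s)
    (fun k _ => hterm k) (Finset.mem_univ i)

lemma damp_exists {a : V → V → ℝ → ℝ} (hW : Weights a) {d : V → ℝ → ℝ} (hd : Gains d)
    {h : V → V → ℝ → ℝ} {hbar : ℝ} (hD : Delays h hbar) {t0 : ℝ} (ht0 : 0 ≤ t0) {M : ℝ}
    (hM : 0 ≤ M) :
    ∃ y : ℝ → V → ℝ, (∀ t ≤ t0, ∀ i, y t i = M) ∧ IsSolDamp a h d hbar t0 y := by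
  set c := dampCoef a d with hcdef
  have hc0 : ∀ s, 0 ≤ c s := dampCoef_nonneg hW hd
  have hci : ∀ u v, IntervalIntegrable c volume u v := dampCoef_int hW hd
  set C : ℝ → ℝ := fun t => ∫ r in t0..(max t t0), c r with hC
  have hCcont : Continuous C :=
    (intervalIntegral.continuous_primitive hci t0).comp (continuous_id.max continuous_const)
  have hCmono : Monotone C := by
    intro u v huv
    refine intervalIntegral.integral_mono_interval le_rfl (le_max_right _ _)
      (max_le_max_right _ huv) (ae_of_all _ hc0) (hci _ _)
  have hC0 : ∀ t, 0 ≤ C t := fun t =>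
    intervalIntegral.integral_nonneg (le_max_right _ _) fun s _ => hc0 s
  have hCt : ∀ t ≤ t0, C t = 0 := fun t ht => by simp [hC, max_eq_right ht]
  set z := dampPicard a h d t0 M with hz
  have hz0 : ∀ t i, z 0 t i = M := fun t i => by simp [hz, dampPicard]
  have hzs : ∀ n t i, z (n+1) t i = ∫ s in t0..(max t t0), rhsDamp a h d (z n) i s :=
    fun n t i => by simp [hz, dampPicard]
  set B : ℕ → ℝ → ℝ := fun n t => M * (C t ^ n / n.factorial) with hB
  have hBmono : ∀ n, Monotone (B n) := by
    intro n u v huv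
    have := pow_le_pow_left₀ (hC0 u) (hCmono huv) n
    simp only [hB]
    gcongr
  have hBcont : ∀ n, Continuous (B n) := fun n => by simp only [hB]; fun_prop
  have hcB : ∀ n u v, IntervalIntegrable (fun s => c s * B n s) volume u v := fun n u v =>
    (hci u v).mul_continuousOn (hBcont n).continuousOn
  have hcBint : ∀ n, ∀ t ≥ t0, (∫ s in t0..t, c s * B n s) = B (n+1) t := by
    intro n t ht
    have e := agg_pow_integral hci t0 t n
    have : (∫ s in t0..t, c s * B n s) =
        ∫ s in t0..t, (M / n.factorial) * (c s * (∫ r in t0..s, c r) ^ n) := by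
      refine intervalIntegral.integral_congr fun s hs => ?_
      rw [uIcc_of_le ht] at hs
      simp only [hB, hC, max_eq_left hs.1]
      ring
    rw [this, intervalIntegral.integral_const_mul, e]
    simp only [hB, hC, max_eq_left ht, Nat.factorial_succ]
    push_cast
    field_simp
  have key : ∀ n, (∀ i, Measurable (fun s => z n s i)) ∧ ∀ t i, |z n t i| ≤ B n t := by
    intro n
    induction n with
    | zero =>
      refine ⟨fun i => by simp only [hz0]; exact measurable_const, fun t i => ?_⟩
      simp [hz0, hB, abs_of_nonneg hM]
    | succ n ih =>
      have hb : ∀ i, ∀ s ≥ t0, |rhsDamp a h d (z n) i s| ≤ c s * B n s := fun i s hs =>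
        rhsDamp_bound hW hd hD (ht0.trans hs)
          (fun r hr k => (ih.2 r k).trans (hBmono n hr)) i
      have hi : ∀ i t, t0 ≤ t → IntervalIntegrable (rhsDamp a h d (z n) i) volume t0 t := by
        intro i t ht
        refine (hcB n t0 t).mono_fun'
          (rhsDamp_meas hW hd hD ih.1 i).aestronglyMeasurable ?_
        refine (ae_restrict_iff' measurableSet_uIoc).2 (ae_of_all _ fun s hs => ?_)
        rw [uIoc_of_le ht] at hs
        exact hb i s hs.1.le
      constructor
      · intro i
        simp only [hzs]
        have hcont : ContinuousOn (fun t => ∫ s in t0..t, rhsDamp a h d (z n) i s) (Ici t0) := by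
          intro t ht
          have := intervalIntegral.continuousOn_primitive_interval' (hi i (t+1) (by
            have : t0 ≤ t := ht
            linarith)) left_mem_uIcc
          have ht' : t0 ≤ t := ht
          rw [uIcc_of_le (by linarith)] at this
          refine (this t ⟨ht, by linarith⟩).mono_of_mem_nhdsWithin ?_
          rw [← Ici_inter_Iic]
          exact inter_mem self_mem_nhdsWithin
            (mem_nhdsWithin_of_mem_nhds (Iic_mem_nhds (by linarith)))
        have : Continuous (fun t => ∫ s in t0..(max t t0), rhsDamp a h d (z n) i s) :=
          hcont.comp_continuous (continuous_id.max continuous_const) fun t => mem_Ici.2 (le_max_right _ _)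
        exact this.measurable
      · intro t i
        rw [hzs]
        have e1 : B (n+1) t = B (n+1) (max t t0) := by simp [hB, hC]
        rw [e1, ← hcBint n _ (le_max_right _ _), ← Real.norm_eq_abs]
        refine intervalIntegral.norm_integral_le_of_norm_le (le_max_right _ _)
          (ae_of_all _ fun s hs => hb i s hs.1.le) (hcB n _ _)
  have hBsum : ∀ t, HasSum (fun n => B n t) (M * Real.exp (C t)) := by
    intro t
    have := NormedSpace.expSeries_div_hasSum_exp (𝔸 := ℝ) (C t)
    rw [← Real.exp_eq_exp_ℝ] at this
    exact this.mul_left M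
  have hzsum : ∀ t i, Summable (fun n => z n t i) := fun t i =>
    Summable.of_norm_bounded (hBsum t).summable fun n => (key n).2 t i
  set y : ℝ → V → ℝ := fun t i => ∑' n, z n t i with hy
  have hyb : ∀ t i, |y t i| ≤ M * Real.exp (C t) := fun t i =>
    tsum_of_norm_bounded (f := fun n => z n t i) (hBsum t) fun n => (key n).2 t i
  have hym : ∀ i, Measurable (fun s => y s i) := by
    intro i
    refine measurable_of_tendsto_metrizable (f := fun N s => ∑ n ∈ Finset.range N, z n s i)
      (fun N => Finset.measurable_sum _ fun n _ => (key n).1 i) ?_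
    rw [tendsto_pi_nhds]
    intro s
    exact (hzsum s i).hasSum.tendsto_sum_nat
  have hzt : ∀ t ≤ t0, ∀ n i, z (n+1) t i = 0 := fun t ht n i => by
    rw [hzs, max_eq_right ht, intervalIntegral.integral_same]
  have hyt : ∀ t ≤ t0, ∀ i, y t i = M := by
    intro t ht i
    simp only [hy]
    rw [(hzsum t i).tsum_eq_zero_add]
    simp [hzt t ht, hz0]
  have hrsum : ∀ i s, HasSum (fun n => rhsDamp a h d (z n) i s) (rhsDamp a h d y i s) := by
    intro i s
    unfold rhsDamp
    refine (((hzsum s i).hasSum.mul_left _).neg).add (hasSum_sum fun j _ => ?_)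
    exact ((hzsum _ j).hasSum.sub (hzsum s i).hasSum).mul_left _
  refine ⟨y, hyt, fun i => (hym i).aestronglyMeasurable, ⟨M, fun s hs i => ?_⟩, fun i t ht => ⟨?_, ?_⟩⟩
  · rw [hyt s hs.2, abs_of_nonneg hM]
  · have hi : IntervalIntegrable (fun s => c s * (M * Real.exp (C s))) volume t0 t :=
      (hci _ _).mul_continuousOn (by fun_prop)
    refine hi.mono_fun' (rhsDamp_meas hW hd hD hym i).aestronglyMeasurable ?_
    refine (ae_restrict_iff' measurableSet_uIoc).2 (ae_of_all _ fun s hs => ?_)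
    rw [uIoc_of_le ht] at hs
    refine rhsDamp_bound hW hd hD (ht0.trans hs.1.le) (fun r hr k => (hyb r k).trans ?_) i
    exact mul_le_mul_of_nonneg_left (Real.exp_le_exp.2 (hCmono hr)) hM
  · rw [hyt t0 le_rfl]
    have hs : HasSum (fun n => ∫ s in t0..t, rhsDamp a h d (z n) i s)
        (∫ s in t0..t, rhsDamp a h d y i s) := by
      refine intervalIntegral.hasSum_integral_of_dominated_convergence (fun n s => c s * B n s)
        (fun n => (rhsDamp_meas hW hd hD (key n).1 i).aestronglyMeasurable) ?_ ?_ ?_ ?_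
      · refine fun n => ae_of_all _ fun s hs => ?_
        rw [uIoc_of_le ht] at hs
        exact rhsDamp_bound hW hd hD (ht0.trans hs.1.le)
          (fun r hr k => ((key n).2 r k).trans (hBmono n hr)) i
      · exact ae_of_all _ fun s _ => ((hBsum s).mul_left _).summable
      · have : (fun s => ∑' n, c s * B n s) = fun s => c s * (M * Real.exp (C s)) :=
          funext fun s => ((hBsum s).mul_left _).tsum_eq
        rw [this]
        exact (hci _ _).mul_continuousOn (by fun_prop)
      · exact ae_of_all _ fun s _ => hrsum i s
    simp only [hy]
    rw [(hzsum t i).tsum_eq_zero_add, hz0, ← hs.tsum_eq]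
    simp only [hzs, max_eq_left ht]

lemma contOn_of_primitive {E : Type*} [NormedAddCommGroup E] [NormedSpace ℝ E]
    {x f : ℝ → E} {t0 : ℝ}
    (hx : ∀ t ≥ t0, IntervalIntegrable f volume t0 t ∧ x t = x t0 + ∫ s in t0..t, f s) :
    ContinuousOn x (Ici t0) := by
  have hcont : ContinuousOn (fun t => ∫ s in t0..t, f s) (Ici t0) := by
    intro t ht
    have ht' : t0 ≤ t := ht
    have := intervalIntegral.continuousOn_primitive_interval'
      (hx (t+1) (by linarith)).1 left_mem_uIcc
    rw [uIcc_of_le (by linarith)] at this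
    refine (this t ⟨ht, by linarith⟩).mono_of_mem_nhdsWithin ?_
    rw [← Ici_inter_Iic]
    exact inter_mem self_mem_nhdsWithin
      (mem_nhdsWithin_of_mem_nhds (Iic_mem_nhds (by linarith)))
  exact (continuousOn_const.add hcont).congr fun t ht => (hx t ht).2

lemma agg_compare {a : V → V → ℝ → ℝ} (hW : Weights a) {d : V → ℝ → ℝ} (hd : Gains d)
    {h : V → V → ℝ → ℝ} {hbar : ℝ} (hD : Delays h hbar)
    {m : ℕ} {Ω : Set (EuclideanSpace ℝ (Fin m))}
    (hne : Ω.Nonempty) (hcl : IsClosed Ω) (hcv : Convex ℝ Ω)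
    {w : V → ℝ → EuclideanSpace ℝ (Fin m)} (hw : ∀ i, ∀ t ≥ (0:ℝ), w i t ∈ Ω)
    {t0 : ℝ} (ht0 : 0 ≤ t0) {x : ℝ → V → EuclideanSpace ℝ (Fin m)}
    (hx : IsSolAgg m a h d w hbar t0 x) {y : ℝ → V → ℝ} (hy : IsSolDamp a h d hbar t0 y)
    (hbar0 : 0 ≤ hbar)
    (hini : ∀ s ∈ Icc (t0 - hbar) t0, ∀ i, Metric.infDist (x s i) Ω < y s i) :
    ∀ t ≥ t0, ∀ i, Metric.infDist (x t i) Ω < y t i := by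
  have hxc : ∀ i, ContinuousOn (fun t => x t i) (Ici t0) := fun i =>
    contOn_of_primitive (hx.2.2 i)
  have hyc : ∀ i, ContinuousOn (fun t => y t i) (Ici t0) := fun i =>
    contOn_of_primitive (hy.2.2 i)
  have hgc : ∀ i, ContinuousOn (fun t => Metric.infDist (x t i) Ω) (Ici t0) := fun i =>
    (Metric.continuous_infDist_pt Ω).comp_continuousOn (hxc i)
  by_contra! hcon
  obtain ⟨T, hT, k, hk⟩ := hcon
  set S : Set ℝ := ⋃ i, {t ∈ Ici t0 | y t i ≤ Metric.infDist (x t i) Ω} with hS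
  have hScl : IsClosed S := by
    refine isClosed_iUnion_of_finite fun i => ?_
    have := (hyc i).prodMk (hgc i)
    exact this.preimage_isClosed_of_isClosed isClosed_Ici
      (isClosed_le continuous_fst continuous_snd)
  have hSne : S.Nonempty := ⟨T, mem_iUnion.2 ⟨k, hT, hk⟩⟩
  have hSb : BddBelow S := ⟨t0, by
    intro t ht
    obtain ⟨i, hi⟩ := mem_iUnion.1 ht
    exact hi.1⟩
  have h1S := hScl.csInf_mem hSne hSb
  set t1 := sInf S with ht1
  obtain ⟨i, ⟨ht01', hi⟩⟩ := mem_iUnion.1 h1S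
  have ht01le : t0 ≤ t1 := ht01'
  have hlt : ∀ t ≥ t0, t < t1 → ∀ j, Metric.infDist (x t j) Ω < y t j := by
    intro t ht htt j
    by_contra! hc
    exact absurd (csInf_le hSb (mem_iUnion.2 ⟨j, ht, hc⟩ : t ∈ S)) (not_le.2 htt)
  have ht01 : t0 < t1 := by
    rcases ht01le.lt_or_eq with h | h
    · exact h
    · rw [← h] at hi
      exact absurd (hini t0 ⟨by linarith, le_rfl⟩ i) (not_lt.2 hi)
  have hle : ∀ t ∈ Icc (t0 - hbar) t1, ∀ j, Metric.infDist (x t j) Ω ≤ y t j := by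
    intro t ht j
    rcases le_or_gt t t0 with h0 | h0
    · exact (hini t ⟨ht.1, h0⟩ j).le
    · have hcl' : IsClosed {t ∈ Icc t0 t1 | Metric.infDist (x t j) Ω ≤ y t j} := by
        have := ((hgc j).mono (Icc_subset_Ici_self : Icc t0 t1 ⊆ Ici t0)).prodMk
          ((hyc j).mono (Icc_subset_Ici_self : Icc t0 t1 ⊆ Ici t0))
        exact this.preimage_isClosed_of_isClosed isClosed_Icc
          (isClosed_le continuous_fst continuous_snd)
      have hsub : closure (Ico t0 t1) ⊆ {t ∈ Icc t0 t1 | Metric.infDist (x t j) Ω ≤ y t j} :=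
        closure_minimal (fun s hs => ⟨⟨hs.1, hs.2.le⟩, (hlt s hs.1 hs.2 j).le⟩) hcl'
      rw [closure_Ico ht01.ne] at hsub
      exact (hsub ⟨h0.le, ht.2⟩).2
  obtain ⟨e, p, he1, he2⟩ := agg_support hne hcl hcv (x t1 i)
  obtain ⟨hxi, hxe⟩ := hx.2.2 i t1 ht01le
  obtain ⟨hyi, hye⟩ := hy.2.2 i t1 ht01le
  set f : ℝ → ℝ := fun s => inner ℝ e (rhsAgg m a h d w x i s) - rhsDamp a h d y i s with hf
  set b : ℝ → ℝ := fun s => d i s + ∑ j ∈ Finset.univ.erase i, a i j s with hb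
  have hin : ∀ t ≥ t0, IntervalIntegrable (fun s => inner ℝ e (rhsAgg m a h d w x i s))
      volume t0 t := by
    intro t ht
    have := (hx.2.2 i t ht).1
    exact ⟨(innerSL ℝ e).integrable_comp this.1, (innerSL ℝ e).integrable_comp this.2⟩
  have hinn : ∀ t ≥ t0, inner ℝ e (∫ s in t0..t, rhsAgg m a h d w x i s) =
      ∫ s in t0..t, inner ℝ e (rhsAgg m a h d w x i s) := by
    intro t ht
    exact ((innerSL ℝ e).intervalIntegral_comp_comm (hx.2.2 i t ht).1).symm
  refine agg_no_touch (ψ := fun t => inner ℝ e (x t i - p) - y t i) (f := f) (b := b) ht01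
    ((hin t1 ht01le).sub hyi) ?_ ?_ ?_ ?_ ?_ ?_
  · rw [intervalIntegrable_iff, uIoc_of_le ht01le]
    have : IntegrableOn b (Icc 0 t1) :=
      Integrable.add ((hd i).2.2 _) (integrable_finsetSum _ fun j hj =>
        (hW i j (Finset.ne_of_mem_erase hj).symm).2.2 _)
    exact this.mono_set fun s hs => ⟨ht0.trans hs.1.le, hs.2⟩
  · intro t ht
    simp only [hf]
    rw [intervalIntegral.integral_sub (hin t ht.1) (hy.2.2 i t ht.1).1, ← hinn t ht.1,
      (hx.2.2 i t ht.1).2, (hy.2.2 i t ht.1).2]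
    simp only [inner_add_right, inner_sub_right, intervalIntegral.integral_same, inner_zero_right]
    ring
  · intro t ht
    have h0 : 0 ≤ t := ht0.trans ht.1
    exact add_nonneg ((hd i).2.1 t h0) (Finset.sum_nonneg fun j hj =>
      (hW i j (Finset.ne_of_mem_erase hj).symm).2.1 t h0)
  · intro s hs
    have h0 : 0 ≤ s := ht0.trans hs.1
    simp only [hf, hb, rhsAgg, rhsDamp, inner_add_right, inner_sum, real_inner_smul_right]
    have hwp : inner ℝ e (w i s - p) ≤ 0 :=
      (he2 _).trans (le_of_eq (Metric.infDist_zero_of_mem (hw i s h0)))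
    have hd1 : d i s * inner ℝ e (w i s - x s i) ≤ - (d i s * inner ℝ e (x s i - p)) := by
      have e1 : w i s - x s i = (w i s - p) - (x s i - p) := by abel
      rw [e1, inner_sub_right]
      nlinarith [(hd i).2.1 s h0]
    have hs1 : ∑ j ∈ Finset.univ.erase i, a i j s * inner ℝ e (x (s - h i j s) j - x s i) ≤
        ∑ j ∈ Finset.univ.erase i, (a i j s * (y (s - h i j s) j - y s i)
          - a i j s * (inner ℝ e (x s i - p) - y s i)) := by
      refine Finset.sum_le_sum fun j hj => ?_
      have ha := (hW i j (Finset.ne_of_mem_erase hj).symm).2.1 s h0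
      have hh := (hD i j).2 s h0
      have e1 : x (s - h i j s) j - x s i = (x (s - h i j s) j - p) - (x s i - p) := by abel
      have e2 := (he2 (x (s - h i j s) j)).trans
        (hle (s - h i j s) ⟨by linarith [hh.2, hs.1], by linarith [hh.1, hs.2]⟩ j)
      rw [e1, inner_sub_right]
      nlinarith
    rw [Finset.sum_sub_distrib, ← Finset.sum_mul] at hs1
    nlinarith
  · intro t ht
    have := he2 (x t i)
    have := hlt t ht.1 ht.2 i
    linarith
  · linarith

theorem stmt16
    (a : V → V → ℝ → ℝ) (hW : Weights a)
    (d : V → ℝ → ℝ) (hd : Gains d)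
    (hbar : ℝ) (hbar0 : 0 ≤ hbar) (h : V → V → ℝ → ℝ) (hD : Delays h hbar) :
    (∀ m : ℕ, 1 ≤ m → ∀ Ω : Set (EuclideanSpace ℝ (Fin m)),
      Ω.Nonempty → IsClosed Ω → Convex ℝ Ω →
      ∀ w : V → ℝ → EuclideanSpace ℝ (Fin m),
        (∀ i : V, Measurable (w i) ∧ (∀ T : ℝ, IntegrableOn (w i) (Icc 0 T)) ∧
          ∀ t ≥ (0:ℝ), w i t ∈ Ω) →
        ∀ tstar ≥ (0:ℝ), ∀ x : ℝ → V → EuclideanSpace ℝ (Fin m),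
          IsSolAgg m a h d w hbar tstar x →
          ∀ i : V, Tendsto (fun t => Metric.infDist (x t i) Ω) atTop (𝓝 0)) ↔
    (∀ tstar ≥ (0:ℝ), ∀ y : ℝ → V → ℝ, IsSolDamp a h d hbar tstar y →
      ∀ i : V, Tendsto (fun t => y t i) atTop (𝓝 0)) := by

  constructor
  · intro H t0 ht0 y hy i
    have key := H 1 le_rfl {0} (singleton_nonempty _) isClosed_singleton (convex_singleton _)
      (fun _ _ => 0) (fun i => ⟨measurable_const, fun T => integrableOn_zero, fun t _ => rfl⟩)
      t0 ht0 (fun t i => y t i • EuclideanSpace.single (0 : Fin 1) (1:ℝ)) ?_ i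
    · simp only [Metric.infDist_singleton, dist_zero_right, norm_smul,
        EuclideanSpace.norm_single, norm_one, mul_one] at key
      exact tendsto_zero_iff_norm_tendsto_zero.2 key
    · obtain ⟨h1, ⟨M, h2⟩, h3⟩ := hy
      refine ⟨fun i => (h1 i).smul_const _, ⟨M, fun s hs i => ?_⟩, fun i t ht => ?_⟩
      · simpa [norm_smul] using h2 s hs i
      · have e : rhsAgg 1 a h d (fun _ _ => 0)
            (fun t i => y t i • EuclideanSpace.single (0 : Fin 1) (1:ℝ)) i =
            fun s => rhsDamp a h d y i s • EuclideanSpace.single (0 : Fin 1) (1:ℝ) := by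
          funext s
          simp only [rhsAgg, rhsDamp, zero_sub, smul_neg, smul_smul, ← sub_smul, add_smul,
            neg_smul, Finset.sum_smul]
          abel
        rw [e]
        obtain ⟨h4, h5⟩ := h3 i t ht
        refine ⟨⟨h4.1.smul_const _, h4.2.smul_const _⟩, ?_⟩
        rw [intervalIntegral.integral_smul_const, ← add_smul, ← h5]
  · intro H m _ Ω hne hcl hcv w hw t0 ht0 x hx i
    obtain ⟨M, hM⟩ := hx.2.1
    obtain ⟨q, hq⟩ := hne
    have hMn : 0 ≤ |M| + ‖q‖ + 1 := by positivity
    obtain ⟨y, hy0, hy⟩ := damp_exists hW hd hD ht0 hMn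
    have hcmp := agg_compare hW hd hD ⟨q, hq⟩ hcl hcv (fun i => (hw i).2.2) ht0 hx hy hbar0 (by
      intro s hs j
      rw [hy0 s hs.2 j]
      have h1 := Metric.infDist_le_dist_of_mem (x := x s j) hq
      have h2 : dist (x s j) q ≤ ‖x s j‖ + ‖q‖ := by rw [dist_eq_norm]; exact norm_sub_le _ _
      linarith [hM s hs j, le_abs_self M])
    refine squeeze_zero' (Eventually.of_forall fun t => Metric.infDist_nonneg) ?_ (H t0 ht0 y hy i)
    filter_upwards [eventually_ge_atTop t0] with t ht
    exact (hcmp t ht i).le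
end
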